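/- Let n ≥ 3, α ≥ n, p > n − 1, and u(t) = e / exp(t^{−α}). Then there is no homeomorphism h : 𝔹 → 𝔹_u with h ∈ W^{1,n}(𝔹, ℝⁿ) (finite conformal energy) whose inverse f = h⁻¹ belongs to W^{1,p}(𝔹_u, ℝⁿ). -/

import Mathlib

open MeasureTheory Metric Set
open scoped ENNReal NNReal

noncomputable section

abbrev Euc (n : ℕ) : Type := EuclideanSpace ℝ (Fin n)

/-- Operator norm of an `n × n` real matrix, viewed as a linear operator on Euclidean space. -/
noncomputable def opNorm {n : ℕ} (M : Matrix (Fin n) (Fin n) ℝ) : ℝ :=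
  ‖LinearMap.toContinuousLinearMap (Matrix.toEuclideanLin M)‖

/-- `g` belongs to the Sobolev class `W^{1,p}(Ω, ℝⁿ)` with weak differential `Dg`:
`g` and `Dg` are locally integrable on `Ω`, the integration-by-parts identity holds against
every smooth compactly supported test function supported in `Ω`, and `|Dg| ∈ L^p(Ω)`. -/
structure MemSobolev {n : ℕ} (p : ℝ) (Ω : Set (Euc n))
    (g : Euc n → Euc n) (Dg : Euc n → Matrix (Fin n) (Fin n) ℝ) : Prop where
  locInt : ∀ i : Fin n, LocallyIntegrableOn (fun x => g x i) Ω volume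
  locIntD : ∀ i j : Fin n, LocallyIntegrableOn (fun x => Dg x i j) Ω volume
  parts : ∀ φ : Euc n → ℝ, ContDiff ℝ ((⊤ : ℕ∞) : WithTop ℕ∞) φ → HasCompactSupport φ →
    tsupport φ ⊆ Ω → ∀ i j : Fin n,
      ∫ x in Ω, g x i * fderiv ℝ φ x (EuclideanSpace.single j 1) =
        - ∫ x in Ω, Dg x i j * φ x
  lp : IntegrableOn (fun x => opNorm (Dg x) ^ p) Ω volume

/-- `g` belongs to the local Sobolev class `W^{1,1}_loc(Ω, ℝⁿ)` with weak differential `Dg`. -/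
structure MemSobolevLoc {n : ℕ} (Ω : Set (Euc n))
    (g : Euc n → Euc n) (Dg : Euc n → Matrix (Fin n) (Fin n) ℝ) : Prop where
  locInt : ∀ i : Fin n, LocallyIntegrableOn (fun x => g x i) Ω volume
  locIntD : ∀ i j : Fin n, LocallyIntegrableOn (fun x => Dg x i j) Ω volume
  parts : ∀ φ : Euc n → ℝ, ContDiff ℝ ((⊤ : ℕ∞) : WithTop ℕ∞) φ → HasCompactSupport φ →
    tsupport φ ⊆ Ω → ∀ i j : Fin n,
      ∫ x in Ω, g x i * fderiv ℝ φ x (EuclideanSpace.single j 1) =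
        - ∫ x in Ω, Dg x i j * φ x

/-- `h : 𝕏 → 𝕐` is a homeomorphism of `𝕏` onto `𝕐` with inverse `f`. -/
structure IsHomeoOn {n : ℕ} (h f : Euc n → Euc n) (𝕏 𝕐 : Set (Euc n)) : Prop where
  mapsTo : Set.MapsTo h 𝕏 𝕐
  mapsTo_inv : Set.MapsTo f 𝕐 𝕏
  left_inv : ∀ x ∈ 𝕏, f (h x) = x
  right_inv : ∀ y ∈ 𝕐, h (f y) = y
  continuousOn : ContinuousOn h 𝕏
  continuousOn_inv : ContinuousOn f 𝕐

/-- The inner distortion function `K_I(·, h)` of a Sobolev map with weak differential `Dh`;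
`D♯h` is the cofactor (adjugate) matrix, given by Cramer's rule `(D♯h)(Dh) = (det Dh)·Id`. -/
noncomputable def innerDistortion {n : ℕ} (Dh : Euc n → Matrix (Fin n) (Fin n) ℝ)
    (x : Euc n) : ℝ≥0∞ :=
  if 0 < (Dh x).det then
    ENNReal.ofReal (opNorm ((Dh x).adjugate) ^ n / (Dh x).det ^ (n - 1))
  else if (Dh x).adjugate = 0 then 1 else ⊤

/-- The open unit ball `𝔹 ⊂ ℝⁿ`. -/
def unitBall (n : ℕ) : Set (Euc n) := Metric.ball 0 1

/-- The slit `I = {(t,0) : 0 ≤ t < 1}`, the first coordinate playing the role of `t`. -/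
def slit (n : ℕ) [NeZero n] : Set (Euc n) :=
  {p | 0 ≤ p 0 ∧ p 0 < 1 ∧ ∀ i : Fin n, i ≠ 0 → p i = 0}

/-- The model inward-cusp ball `𝔹_u = 𝔹 \ {(t,x) : t ≥ 0, |x| ≤ u(t)}`. -/
noncomputable def cuspBall (n : ℕ) [NeZero n] (u : ℝ → ℝ) : Set (Euc n) :=
  Metric.ball 0 1 \
    {p | 0 ≤ p 0 ∧ Real.sqrt (∑ i ∈ Finset.univ.erase (0 : Fin n), p i ^ 2) ≤ u (p 0)}

/-- `u` is a model cusp profile: a strictly increasing continuous surjection of `[0,∞)` onto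
itself, `C¹` on `(0,∞)`, with `u′` increasing on `(0,∞)`, `u′(s) → 0` as `s → 0⁺`, `u(1) = 1`. -/
structure IsModelCusp (u : ℝ → ℝ) : Prop where
  continuousOn : ContinuousOn u (Set.Ici 0)
  contDiffOn : ContDiffOn ℝ 1 u (Set.Ioi 0)
  strictMonoOn : StrictMonoOn u (Set.Ici 0)
  mapsTo : Set.MapsTo u (Set.Ici 0) (Set.Ici 0)
  surjOn : Set.SurjOn u (Set.Ici 0) (Set.Ici 0)
  deriv_mono : MonotoneOn (deriv u) (Set.Ioi 0)
  deriv_tendsto : Filter.Tendsto (deriv u) (nhdsWithin 0 (Set.Ioi 0)) (nhds 0)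
  one : u 1 = 1

/-- The cusp profile `u(t) = e / exp(t^{-α})` for `t > 0`, and `u(0) = 0`. -/
noncomputable def cuspFun (α : ℝ) (t : ℝ) : ℝ :=
  if 0 < t then Real.exp 1 / Real.exp (t ^ (-α)) else 0

/-- The sphere `S_t = {y ∈ 𝔹_u : |y| = t}` inside the cusp ball. -/
def cuspS (n : ℕ) [NeZero n] (u : ℝ → ℝ) (t : ℝ) : Set (Euc n) :=
  {y ∈ cuspBall n u | ‖y‖ = t}

/-- The boundary circle `C_t = {y ∈ ∂𝔹_u : |y| = t}`. -/
def cuspC (n : ℕ) [NeZero n] (u : ℝ → ℝ) (t : ℝ) : Set (Euc n) :=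
  {y ∈ frontier (cuspBall n u) | ‖y‖ = t}

/-- `S′_t = h⁻¹(S_t) ⊆ 𝔹`. -/
def cuspS' (n : ℕ) [NeZero n] (u : ℝ → ℝ) (h : Euc n → Euc n) (t : ℝ) : Set (Euc n) :=
  {x ∈ unitBall n | h x ∈ cuspS n u t}

/-- `C′_t = cl(S′_t) ∩ ∂𝔹`. -/
def cuspC' (n : ℕ) [NeZero n] (u : ℝ → ℝ) (h : Euc n → Euc n) (t : ℝ) : Set (Euc n) :=
  closure (cuspS' n u h t) ∩ Metric.sphere (0 : Euc n) 1

theorem holder_one {X : Type*} [MeasurableSpace X] (μ : Measure X) {p : ℝ} (hp : 1 < p)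
    {F : X → ℝ≥0∞} (hF : AEMeasurable F μ) :
    ∫⁻ x, F x ∂μ ≤ (∫⁻ x, F x ^ p ∂μ) ^ (1 / p) * μ univ ^ (1 - 1 / p) := by
  have hpq : p.HolderConjugate (p / (p - 1)) := Real.HolderConjugate.conjExponent hp
  have h := ENNReal.lintegral_mul_le_Lp_mul_Lq μ hpq hF (g := fun _ => 1) aemeasurable_const
  have e : 1 / (p / (p - 1)) = 1 - 1 / p := by
    have : p ≠ 0 := by linarith
    field_simp
  simpa [e] using h

theorem lintegral_scale_le {m : ℕ} (Q : Set (Euc m)) (hQ : MeasurableSet Q) (hc : Convex ℝ Q)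
    {x : Euc m} (hx : x ∈ Q) {s : ℝ} (hs : s ∈ Ioo (0 : ℝ) 1) {F : Euc m → ℝ≥0∞}
    (hF : Measurable F) :
    ∫⁻ y in Q, F (x + s • (y - x)) ≤ ENNReal.ofReal (s ^ (-(m : ℝ))) * ∫⁻ y in Q, F y := by
  have h1 : ∫⁻ y in Q, F (x + s • (y - x)) ≤ ∫⁻ y, Q.indicator F (x + s • (y - x)) := by
    rw [← lintegral_indicator hQ]
    apply lintegral_mono
    intro y
    by_cases hy : y ∈ Q
    · have : x + s • (y - x) ∈ Q := by
        have := hc.add_smul_sub_mem hx hy (t := s) ⟨hs.1.le, hs.2.le⟩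
        exact this
      simp [hy, this]
    · simp [hy]
  refine h1.trans (le_of_eq ?_)
  have hFi : Measurable (Q.indicator F) := hF.indicator hQ
  have h2 : ∀ y, Q.indicator F (x + s • (y - x)) = (fun z => Q.indicator F ((x - s • x) + z)) (s • y) := by
    intro y; simp only [smul_sub]; congr 1; abel
  simp_rw [h2]
  have hmz : Measurable (fun z => Q.indicator F ((x - s • x) + z)) :=
    hFi.comp (measurable_const_add _)
  rw [← lintegral_map (f := fun z => Q.indicator F ((x - s • x) + z)) (g := fun y => s • y) hmz
    (measurable_const_smul s)]
  rw [Measure.map_addHaar_smul _ hs.1.ne', lintegral_smul_measure,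
    lintegral_add_left_eq_self (μ := (volume : Measure (Euc m))) (Q.indicator F), lintegral_indicator hQ]
  simp only [smul_eq_mul, finrank_euclideanSpace, Fintype.card_fin]
  congr 2
  rw [abs_of_pos (by have := hs.1; positivity), Real.rpow_neg hs.1.le, Real.rpow_natCast]

theorem lintegral_rpow_finite {a : ℝ} (ha : a < 1) :
    ∫⁻ s in Ioo (0 : ℝ) 1, ENNReal.ofReal (s ^ (-a)) < ⊤ := by
  have h : IntegrableOn (fun s : ℝ => s ^ (-a)) (Ioo 0 1) := by
    rw [intervalIntegral.integrableOn_Ioo_rpow_iff one_pos]; linarith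
  have := h.lintegral_lt_top
  exact this

theorem morrey_avg {m : ℕ} {p : ℝ} (hp1 : 1 < p)
    {G : Euc m → ℝ} (hG : ContDiff ℝ 1 G) {Q : Set (Euc m)} (hQ : MeasurableSet Q)
    (hc : Convex ℝ Q) {x : Euc m} (hx : x ∈ Q) {d : ℝ≥0∞} (hd : ∀ y ∈ Q, ‖y - x‖ₑ ≤ d) :
    ∫⁻ y in Q, ‖G y - G x‖ₑ ≤ (∫⁻ s in Ioo (0 : ℝ) 1, ENNReal.ofReal (s ^ (-(m / p : ℝ)))) *
      (d * volume Q ^ (1 - 1 / p) * (∫⁻ y in Q, ‖fderiv ℝ G y‖ₑ ^ p) ^ (1 / p)) := by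
  have hcont : Continuous (fderiv ℝ G) := hG.continuous_fderiv (by norm_num)
  have hFm : Measurable (fun y => ‖fderiv ℝ G y‖ₑ) := hcont.enorm.measurable
  -- pointwise
  have hpt : ∀ y ∈ Q, ‖G y - G x‖ₑ ≤
      ∫⁻ s in Ioo (0 : ℝ) 1, ‖fderiv ℝ G (x + s • (y - x))‖ₑ * d := by
    intro y hy
    have hder : ∀ s ∈ uIcc (0 : ℝ) 1, HasDerivAt (fun s : ℝ => G (x + s • (y - x)))
        (fderiv ℝ G (x + s • (y - x)) (y - x)) s := by
      intro s _
      have h1 : HasDerivAt (fun s : ℝ => x + s • (y - x)) (y - x) s := by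
        simpa using ((hasDerivAt_id s).smul_const (y - x)).const_add x
      exact ((hG.differentiable (by norm_num)).differentiableAt.hasFDerivAt).comp_hasDerivAt s h1
    have hci : Continuous (fun s : ℝ => fderiv ℝ G (x + s • (y - x)) (y - x)) := by
      have : Continuous (fun s : ℝ => fderiv ℝ G (x + s • (y - x))) :=
        hcont.comp (by fun_prop)
      exact this.clm_apply continuous_const
    have := intervalIntegral.integral_eq_sub_of_hasDerivAt hder (hci.intervalIntegrable _ _)
    simp only [one_smul, zero_smul, add_zero, add_sub_cancel] at this
    rw [← this, intervalIntegral.integral_of_le zero_le_one, ← integral_Ioc_eq_integral_Ioo.symm]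
    refine (enorm_integral_le_lintegral_enorm _).trans ?_
    refine lintegral_mono fun s => ?_
    refine (ContinuousLinearMap.le_opENorm _ _).trans ?_
    gcongr
    exact hd y hy
  calc ∫⁻ y in Q, ‖G y - G x‖ₑ
      ≤ ∫⁻ y in Q, ∫⁻ s in Ioo (0 : ℝ) 1, ‖fderiv ℝ G (x + s • (y - x))‖ₑ * d :=
        setLIntegral_mono' hQ hpt
    _ = ∫⁻ s in Ioo (0 : ℝ) 1, ∫⁻ y in Q, ‖fderiv ℝ G (x + s • (y - x))‖ₑ * d := by
        apply lintegral_lintegral_swap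
        apply Measurable.aemeasurable
        apply Measurable.mul_const
        apply hFm.comp
        apply Continuous.measurable
        fun_prop
    _ ≤ ∫⁻ s in Ioo (0 : ℝ) 1, ENNReal.ofReal (s ^ (-(m / p : ℝ))) *
         (d * volume Q ^ (1 - 1 / p) * (∫⁻ y in Q, ‖fderiv ℝ G y‖ₑ ^ p) ^ (1 / p)) := by
        apply setLIntegral_mono' measurableSet_Ioo
        intro s hs
        have hm1 : Measurable (fun y => ‖fderiv ℝ G (x + s • (y - x))‖ₑ) :=
          hFm.comp (by fun_prop)
        rw [lintegral_mul_const _ hm1]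
        have h1 := holder_one (volume.restrict Q) hp1 hm1.aemeasurable
        have h2 := lintegral_scale_le Q hQ hc hx hs (F := fun y => ‖fderiv ℝ G y‖ₑ ^ p)
          (hFm.pow_const p)
        have h3 : (∫⁻ y in Q, ‖fderiv ℝ G (x + s • (y - x))‖ₑ ^ p) ^ (1 / p) ≤
            ENNReal.ofReal (s ^ (-(m / p : ℝ))) * (∫⁻ y in Q, ‖fderiv ℝ G y‖ₑ ^ p) ^ (1 / p) := by
          refine (ENNReal.rpow_le_rpow h2 (by positivity)).trans (le_of_eq ?_)
          rw [ENNReal.mul_rpow_of_nonneg _ _ (by positivity),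
            ENNReal.ofReal_rpow_of_nonneg (Real.rpow_nonneg hs.1.le _) (by positivity),
            ← Real.rpow_mul hs.1.le]
          congr 3
          ring
        calc _ ≤ _ := mul_le_mul_left h1 d
          _ ≤ _ := mul_le_mul_left (mul_le_mul_left h3 _) _
          _ = _ := by rw [Measure.restrict_apply_univ]; ring
    _ = _ := by
        rw [lintegral_mul_const]
        apply Measurable.ennreal_ofReal
        fun_prop

theorem morrey_two {m : ℕ} {p : ℝ} (hp1 : 1 < p)
    {G : Euc m → ℝ} (hG : ContDiff ℝ 1 G) {Q : Set (Euc m)} (hQ : IsCompact Q)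
    (hc : Convex ℝ Q) {x y : Euc m} (hx : x ∈ Q) (hy : y ∈ Q) {d : ℝ≥0∞}
    (hd : ∀ y ∈ Q, ∀ x ∈ Q, ‖y - x‖ₑ ≤ d) :
    ‖G x - G y‖ₑ * volume Q ≤ 2 * ((∫⁻ s in Ioo (0 : ℝ) 1, ENNReal.ofReal (s ^ (-(m / p : ℝ)))) *
      (d * volume Q ^ (1 - 1 / p) * (∫⁻ y in Q, ‖fderiv ℝ G y‖ₑ ^ p) ^ (1 / p))) := by
  have hx' := morrey_avg hp1 hG hQ.measurableSet hc hx (fun y hy => hd y hy x hx)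
  have hy' := morrey_avg hp1 hG hQ.measurableSet hc hy (fun z hz => hd z hz y hy)
  rw [two_mul]
  refine le_trans ?_ (add_le_add hx' hy')
  rw [← lintegral_add_left (by have := hG.continuous; fun_prop), ← setLIntegral_const]
  apply lintegral_mono
  intro z
  calc ‖G x - G y‖ₑ = ‖-(G z - G x) + (G z - G y)‖ₑ := by congr 1; ring
    _ ≤ _ := (enorm_add_le _ _).trans (by rw [enorm_neg])

theorem morrey_const (m : ℕ) {p : ℝ} (hp1 : 1 < p) (hp : (m : ℝ) < p) (K : ℝ) :
    ∃ C : ℝ≥0∞, C < ⊤ ∧ ∀ (G : Euc m → ℝ), ContDiff ℝ 1 G → ∀ (Q : Set (Euc m)), IsCompact Q →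
      Convex ℝ Q → ∀ (c : Euc m) (ρ : ℝ), 0 < ρ → closedBall c ρ ⊆ Q →
      (∀ y ∈ Q, ∀ x ∈ Q, ‖y - x‖ ≤ K * ρ) → ∀ x ∈ Q, ∀ y ∈ Q,
      ‖G x - G y‖ₑ ≤ C * ENNReal.ofReal (ρ ^ (1 - m / p)) *
        (∫⁻ y in Q, ‖fderiv ℝ G y‖ₑ ^ p) ^ (1 / p) := by
  set I := (∫⁻ s in Ioo (0 : ℝ) 1, ENNReal.ofReal (s ^ (-(m / p : ℝ)))) with hI
  have hIfin : I < ⊤ := lintegral_rpow_finite (by rw [div_lt_one (by linarith)]; exact hp)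
  set v := volume (closedBall (0 : Euc m) 1) with hv
  have hv0 : v ≠ 0 := (measure_closedBall_pos _ _ one_pos).ne'
  have hvt : v ≠ ⊤ := measure_closedBall_lt_top.ne
  have hp0 : 0 < p := by linarith
  refine ⟨2 * I * ENNReal.ofReal K * v ^ (-(1 / p)), ?_, ?_⟩
  · refine ENNReal.mul_lt_top (ENNReal.mul_lt_top (ENNReal.mul_lt_top (by simp) hIfin) (by simp)) ?_
    exact (ENNReal.rpow_ne_top_of_ne_zero hv0 hvt).lt_top
  intro G hG Q hQ hc c ρ hρ hcQ hd x hx y hy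
  have h := morrey_two hp1 hG hQ hc hx hy (d := ENNReal.ofReal (K * ρ)) (by
    intro y hy x hx
    rw [← ofReal_norm]; exact ENNReal.ofReal_le_ofReal (hd y hy x hx))
  rw [← hI] at h
  set N := (∫⁻ y in Q, ‖fderiv ℝ G y‖ₑ ^ p) ^ (1 / p) with hN
  have hvol : ENNReal.ofReal (ρ ^ m) * v ≤ volume Q := by
    have := Measure.addHaar_closedBall (volume : Measure (Euc m)) c hρ.le
    have h2 := Measure.addHaar_unitClosedBall_eq_addHaar_unitBall (volume : Measure (Euc m))
    simp only [finrank_euclideanSpace, Fintype.card_fin] at this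
    rw [hv, h2, ← this]
    exact measure_mono hcQ
  have hq0 : volume Q ≠ 0 := by
    have : 0 < ENNReal.ofReal (ρ ^ m) * v := by
      apply ENNReal.mul_pos _ hv0
      simp; positivity
    exact (this.trans_le hvol).ne'
  have hqt : volume Q ≠ ⊤ := hQ.measure_lt_top.ne
  have h1 : ‖G x - G y‖ₑ ≤ 2 * I * ENNReal.ofReal (K * ρ) * N * volume Q ^ (-(1 / p)) := by
    have h2 : ‖G x - G y‖ₑ = ‖G x - G y‖ₑ * volume Q * (volume Q)⁻¹ := by
      rw [mul_assoc, ENNReal.mul_inv_cancel hq0 hqt, mul_one]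
    rw [h2]
    refine (mul_le_mul_left h _).trans (le_of_eq ?_)
    have : volume Q ^ (-(1 / p)) = volume Q ^ (1 - 1 / p) * (volume Q)⁻¹ := by
      rw [← ENNReal.rpow_neg_one, ← ENNReal.rpow_add _ _ hq0 hqt]; congr 1; ring
    rw [this]; ring
  have h3 : volume Q ^ (-(1 / p)) ≤ ENNReal.ofReal (ρ ^ (-(m / p : ℝ))) * v ^ (-(1 / p)) := by
    have e : ENNReal.ofReal (ρ ^ (-(m / p : ℝ))) * v ^ (-(1 / p)) =
        (ENNReal.ofReal (ρ ^ m) * v) ^ (-(1 / p)) := by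
      rw [ENNReal.mul_rpow_of_ne_top (by simp) hvt, ENNReal.ofReal_rpow_of_pos (by positivity),
        ← Real.rpow_natCast, ← Real.rpow_mul hρ.le]
      congr 3; ring
    rw [e, ENNReal.rpow_neg, ENNReal.rpow_neg]
    exact ENNReal.inv_le_inv.2 (ENNReal.rpow_le_rpow hvol (by positivity))
  refine h1.trans ((mul_le_mul_right h3 _).trans (le_of_eq ?_))
  have e1 : ENNReal.ofReal (K * ρ) = ENNReal.ofReal K * ENNReal.ofReal ρ := 
    ENNReal.ofReal_mul' hρ.le
  have e2 : ENNReal.ofReal (ρ ^ (1 - m / p : ℝ)) =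
      ENNReal.ofReal ρ * ENNReal.ofReal (ρ ^ (-(m / p : ℝ))) := by
    rw [← ENNReal.ofReal_mul hρ.le, sub_eq_add_neg, Real.rpow_add hρ, Real.rpow_one]
  rw [e1, e2]; ring

theorem jensen_mass {X : Type*} [MeasurableSpace X] (μ : Measure X) {p : ℝ} (hp : 1 < p)
    {k F : X → ℝ≥0∞} (hk : Measurable k) (hk1 : ∫⁻ x, k x ∂μ = 1) (hF : AEMeasurable F μ) :
    (∫⁻ x, k x * F x ∂μ) ^ p ≤ ∫⁻ x, k x * F x ^ p ∂μ := by
  have h := holder_one (μ.withDensity k) hp (F := F)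
    (hF.mono_ac (withDensity_absolutelyContinuous _ _))
  rw [lintegral_withDensity_eq_lintegral_mul₀ hk.aemeasurable hF,
    lintegral_withDensity_eq_lintegral_mul₀ hk.aemeasurable (hF.pow_const p)] at h
  have : (μ.withDensity k) univ = 1 := by simp [hk1]
  rw [this, ENNReal.one_rpow, mul_one] at h
  have h2 := ENNReal.rpow_le_rpow h (z := p) (by linarith)
  rw [← ENNReal.rpow_mul, one_div_mul_cancel (by linarith), ENNReal.rpow_one] at h2
  exact h2

theorem row_le_opNorm {n : ℕ} (M : Matrix (Fin n) (Fin n) ℝ) (a : Fin n) (v : Euc n) :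
    ‖∑ j, M a j * v j‖ ≤ opNorm M * ‖v‖ := by
  have h1 : (Matrix.toEuclideanLin M v) a = ∑ j, M a j * v j := by
    simp [Matrix.toEuclideanLin, Matrix.mulVec, dotProduct]
  rw [← h1]
  refine (PiLp.norm_apply_le _ a).trans ?_
  exact ContinuousLinearMap.le_opNorm (LinearMap.toContinuousLinearMap (Matrix.toEuclideanLin M)) v

theorem mollify_deriv {n : ℕ} {p : ℝ} (hp : 1 < p) {Ω : Set (Euc n)} (hΩ : MeasurableSet Ω)
    {g : Euc n → Euc n} {Dg : Euc n → Matrix (Fin n) (Fin n) ℝ} (hS : MemSobolev p Ω g Dg)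
    (a : Fin n) {K : Set (Euc n)} (hK : IsCompact K) (hKΩ : K ⊆ Ω)
    (φ : ContDiffBump (0 : Euc n)) {z : Euc n} (hz : closedBall z φ.rOut ⊆ K)
    {U : Set (Euc n)} (hU : MeasurableSet U) (hUΩ : U ⊆ Ω) (hzU : closedBall z φ.rOut ⊆ U) :
    ‖fderiv ℝ (convolution (K.indicator (fun y => g y a)) (φ.normed volume)
        (ContinuousLinearMap.lsmul ℝ ℝ) volume) z‖ₑ ^ p ≤
      ∫⁻ y, ENNReal.ofReal (φ.normed volume (z - y)) *
        U.indicator (fun y => ENNReal.ofReal (opNorm (Dg y) ^ p)) y := by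
  set gt : Euc n → ℝ := K.indicator (fun y => g y a) with hgt
  set ψ := φ.normed (volume : Measure (Euc n)) with hψ
  have hψc : HasCompactSupport ψ := φ.hasCompactSupport_normed
  have hψs : ContDiff ℝ ((⊤ : ℕ∞) : WithTop ℕ∞) ψ := φ.contDiff_normed
  have hψ1 : ContDiff ℝ 1 ψ := φ.contDiff_normed (n := 1)
  have hψ0 : ∀ y, 0 ≤ ψ y := φ.nonneg_normed
  have hp0 : 0 < p := by linarith
  have hgtI : Integrable gt := by
    rw [hgt, integrable_indicator_iff hK.measurableSet]
    exact (hS.locInt a).integrableOn_compact_subset hKΩ hK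
  have hsupp : ∀ y, y ∉ closedBall z φ.rOut → z - y ∉ tsupport ψ := by
    intro y hy h
    rw [hψ, φ.tsupport_normed_eq] at h
    apply hy
    rw [mem_closedBall, dist_eq_norm, norm_sub_rev]
    simpa using h
  have hψz : ∀ y, y ∉ closedBall z φ.rOut → ψ (z - y) = 0 := fun y hy =>
    image_eq_zero_of_notMem_tsupport (hsupp y hy)
  have hdψz : ∀ y, y ∉ closedBall z φ.rOut → fderiv ℝ ψ (z - y) = 0 := fun y hy =>
    image_eq_zero_of_notMem_tsupport (fun h => hsupp y hy (tsupport_fderiv_subset ℝ h))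
  -- derivative of the convolution
  have hfd := hψc.hasFDerivAt_convolution_right (ContinuousLinearMap.lsmul ℝ ℝ)
    hgtI.locallyIntegrable hψ1 z
  have hval : ∀ v, fderiv ℝ (convolution gt ψ (ContinuousLinearMap.lsmul ℝ ℝ) volume) z v =
      ∫ t, gt t * fderiv ℝ ψ (z - t) v := by
    intro v
    rw [hfd.fderiv, convolution]
    have hex : ConvolutionExistsAt gt (fderiv ℝ ψ) z
        ((ContinuousLinearMap.lsmul ℝ ℝ).precompR (Euc n)) volume :=
      (hψc.fderiv ℝ).convolutionExists_right _ hgtI.locallyIntegrable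
        (hψ1.continuous_fderiv (by norm_num)) z
    rw [ContinuousLinearMap.integral_apply hex]
    rfl
  have hcol : ∀ j, ∫ t, gt t * fderiv ℝ ψ (z - t) (EuclideanSpace.single j 1) =
      ∫ t in Ω, Dg t a j * ψ (z - t) := by
    intro j
    have hts : tsupport (fun y => ψ (z - y)) ⊆ closedBall z φ.rOut := by
      apply closure_minimal _ isClosed_closedBall
      intro y hy
      by_contra hc
      exact hy (hψz y hc)
    have hparts := hS.parts (fun y => ψ (z - y)) (hψs.comp (contDiff_const.sub contDiff_id))
      (HasCompactSupport.intro (isCompact_closedBall z φ.rOut) hψz) (hts.trans (hz.trans hKΩ)) a j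
    have hfdv : ∀ y, fderiv ℝ (fun y => ψ (z - y)) y (EuclideanSpace.single j 1) =
        - fderiv ℝ ψ (z - y) (EuclideanSpace.single j 1) := by
      intro y
      have h1 : HasFDerivAt (fun y : Euc n => z - y) (-ContinuousLinearMap.id ℝ (Euc n)) y :=
        (hasFDerivAt_id y).const_sub z
      have h2 := ((hψ1.differentiable (by norm_num)) (z - y)).hasFDerivAt.comp y h1
      have h3 : fderiv ℝ (fun y => ψ (z - y)) y = _ := h2.fderiv
      rw [h3]; simp
    simp_rw [hfdv, mul_neg] at hparts
    rw [integral_neg, neg_inj] at hparts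
    rw [← hparts]
    symm
    rw [← integral_indicator hΩ]
    apply integral_congr_ae
    refine Filter.Eventually.of_forall fun t => ?_
    by_cases ht : t ∈ closedBall z φ.rOut
    · simp [hgt, hz ht, hKΩ (hz ht)]
    · simp [hdψz t ht, Set.indicator]
  have hIntg : ∀ j, IntegrableOn (fun t => Dg t a j * ψ (z - t)) Ω := by
    intro j
    have h1 : IntegrableOn (fun t => Dg t a j * ψ (z - t)) (closedBall z φ.rOut) := by
      apply IntegrableOn.mul_continuousOn
      · exact (hS.locIntD a j).integrableOn_compact_subset (hz.trans hKΩ) (isCompact_closedBall _ _)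
      · have := hψ1.continuous; fun_prop
      · exact isCompact_closedBall _ _
    rw [integrableOn_iff_integrable_of_support_subset] at h1
    · exact h1.integrableOn
    · intro t ht
      by_contra hc
      exact ht (by simp [hψz t hc])
  have hlin : ∀ v : Euc n, fderiv ℝ (convolution gt ψ (ContinuousLinearMap.lsmul ℝ ℝ) volume) z v =
      ∫ t in Ω, (∑ j, Dg t a j * v j) * ψ (z - t) := by
    intro v
    have hv : v = ∑ j, v j • (EuclideanSpace.single j (1 : ℝ) : Euc n) := by
      ext i
      simp [Finset.sum_apply, Pi.single_apply]
    conv_lhs => rw [hv]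
    rw [map_sum]
    simp_rw [map_smul, hval, hcol]
    have : ∀ t, (∑ j, Dg t a j * v j) * ψ (z - t) = ∑ j, v j • (Dg t a j * ψ (z - t)) := by
      intro t; rw [Finset.sum_mul]; apply Finset.sum_congr rfl; intro j _
      simp only [smul_eq_mul]; ring
    simp_rw [this]
    rw [integral_finsetSum]
    · simp_rw [integral_smul]
    · intro j _
      exact (hIntg j).smul (v j)
  set w : Euc n → ℝ≥0∞ := U.indicator (fun y => ENNReal.ofReal (opNorm (Dg y) ^ p)) with hw
  have hwm : AEMeasurable w := by
    rw [hw, aemeasurable_indicator_iff hU]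
    exact ((hS.lp.mono_set hUΩ).aemeasurable).ennreal_ofReal
  have hop0 : ∀ M : Matrix (Fin n) (Fin n) ℝ, 0 ≤ opNorm M := fun M => norm_nonneg _
  have hFw : ∀ y ∈ U, w y ^ (1 / p) = ENNReal.ofReal (opNorm (Dg y)) := by
    intro y hy
    rw [hw, Set.indicator_of_mem hy, ENNReal.ofReal_rpow_of_nonneg (by have := hop0 (Dg y); positivity)
      (by positivity), ← Real.rpow_mul (hop0 _), mul_one_div_cancel hp0.ne', Real.rpow_one]
  have hbound : ‖fderiv ℝ (convolution gt ψ (ContinuousLinearMap.lsmul ℝ ℝ) volume) z‖ₑ ≤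
      ∫⁻ y, ENNReal.ofReal (ψ (z - y)) * w y ^ (1 / p) := by
    refine ContinuousLinearMap.opENorm_le_bound _ fun v => ?_
    rw [hlin v]
    refine (enorm_integral_le_lintegral_enorm _).trans ?_
    rw [← lintegral_indicator hΩ, ← lintegral_mul_const' _ _ enorm_ne_top]
    apply lintegral_mono
    intro t
    by_cases ht : t ∈ closedBall z φ.rOut
    · beta_reduce
      rw [Set.indicator_of_mem (hKΩ (hz ht)), hFw t (hzU ht), enorm_mul, Real.enorm_of_nonneg (hψ0 _)]
      have := row_le_opNorm (Dg t) a v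
      have h2 : ‖∑ j, Dg t a j * v j‖ₑ ≤ ENNReal.ofReal (opNorm (Dg t)) * ‖v‖ₑ := by
        rw [← ofReal_norm, ← ofReal_norm, ← ENNReal.ofReal_mul (hop0 _)]
        exact ENNReal.ofReal_le_ofReal this
      calc _ ≤ _ := mul_le_mul_left h2 _
        _ = _ := by ring
    · simp [hψz t ht, Set.indicator]
  refine (ENNReal.rpow_le_rpow hbound hp0.le).trans ?_
  have hmass : ∫⁻ y, ENNReal.ofReal (ψ (z - y)) = 1 := by
    rw [lintegral_sub_left_eq_self (fun y => ENNReal.ofReal (ψ y)) z,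
      ← ofReal_integral_eq_lintegral_ofReal φ.integrable_normed
        (Filter.Eventually.of_forall hψ0), φ.integral_normed]
    simp
  have hj := jensen_mass volume hp (k := fun y => ENNReal.ofReal (ψ (z - y)))
    (F := fun y => w y ^ (1 / p)) (by have := hψ1.continuous; fun_prop) hmass (hwm.pow_const _)
  refine hj.trans (le_of_eq ?_)
  congr 1; ext y
  rw [← ENNReal.rpow_mul, one_div_mul_cancel hp0.ne', ENNReal.rpow_one]

/-- Insert the coordinate `s` at position `i`. -/
def ins {m : ℕ} (i : Fin (m + 1)) (s : ℝ) (x : Euc m) : Euc (m + 1) :=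
  WithLp.toLp 2 (i.insertNth (α := fun _ => ℝ) s (WithLp.ofLp x))

@[simp] theorem ins_same {m : ℕ} (i : Fin (m + 1)) (s : ℝ) (x : Euc m) : ins i s x i = s := by
  simp [ins]

@[simp] theorem ins_succAbove {m : ℕ} (i : Fin (m + 1)) (s : ℝ) (x : Euc m) (j : Fin m) :
    ins i s x (i.succAbove j) = x j := by
  simp [ins]

theorem norm_ins_sq {m : ℕ} (i : Fin (m + 1)) (s : ℝ) (x : Euc m) :
    ‖ins i s x‖ ^ 2 = s ^ 2 + ‖x‖ ^ 2 := by
  rw [EuclideanSpace.norm_sq_eq, EuclideanSpace.norm_sq_eq, Fin.sum_univ_succAbove _ i]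
  simp

theorem ins_ext {m : ℕ} (i : Fin (m + 1)) {v w : Euc (m + 1)} (h : v i = w i)
    (h' : ∀ j, v (i.succAbove j) = w (i.succAbove j)) : v = w := by
  ext k
  rcases Fin.eq_self_or_eq_succAbove i k with rfl | ⟨j, rfl⟩
  · exact h
  · exact h' j

theorem ins_add {m : ℕ} (i : Fin (m + 1)) (s t : ℝ) (x y : Euc m) :
    ins i s x + ins i t y = ins i (s + t) (x + y) :=
  ins_ext i (by simp) (by simp)

theorem ins_sub {m : ℕ} (i : Fin (m + 1)) (s t : ℝ) (x y : Euc m) :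
    ins i s x - ins i t y = ins i (s - t) (x - y) :=
  ins_ext i (by simp) (by simp)

theorem ins_smul {m : ℕ} (i : Fin (m + 1)) (c s : ℝ) (x : Euc m) :
    c • ins i s x = ins i (c * s) (c • x) :=
  ins_ext i (by simp) (by simp)

/-- Linear part of the insertion. -/
def insLin {m : ℕ} (i : Fin (m + 1)) : Euc m →ₗᵢ[ℝ] Euc (m + 1) where
  toFun x := ins i 0 x
  map_add' x y := by rw [ins_add]; simp
  map_smul' c x := by simp [ins_smul]
  norm_map' x := by
    have := norm_ins_sq i 0 x
    simp only [ne_eq, OfNat.ofNat_ne_zero, not_false_eq_true, zero_pow, zero_add] at this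
    exact (sq_eq_sq₀ (norm_nonneg _) (norm_nonneg _)).1 this

theorem ins_eq {m : ℕ} (i : Fin (m + 1)) (s : ℝ) (x : Euc m) :
    ins i s x = ins i s 0 + insLin i x := by
  change _ = ins i s 0 + ins i 0 x
  rw [ins_add]; simp

theorem continuous_ins {m : ℕ} (i : Fin (m + 1)) :
    Continuous (fun q : ℝ × Euc m => ins i q.1 q.2) := by
  apply (PiLp.continuous_toLp 2 _).comp
  apply Continuous.finInsertNth
  · exact continuous_fst
  · exact (PiLp.continuous_ofLp 2 _).comp continuous_snd

theorem tonelli_ins {m : ℕ} (L : Euc (m + 1) ≃ₗᵢ[ℝ] Euc (m + 1)) (i : Fin (m + 1))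
    {F : Euc (m + 1) → ℝ≥0∞} (hF : Measurable F) :
    ∫⁻ s, ∫⁻ x, F (L (ins i s x)) = ∫⁻ y, F y := by
  rw [← L.measurePreserving.lintegral_comp hF]
  have h1 := (PiLp.volume_preserving_toLp (Fin (m + 1))).lintegral_comp
    (hF.comp L.continuous.measurable)
  simp only [Function.comp_def] at h1
  rw [← h1]
  have hm1 : Measurable (fun y : Fin (m + 1) → ℝ => F (L (WithLp.toLp 2 y))) :=
    (hF.comp L.continuous.measurable).comp (PiLp.continuous_toLp 2 _).measurable
  rw [← (volume_preserving_piFinSuccAbove (fun _ : Fin (m + 1) => ℝ) i).symm.lintegral_comp hm1]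
  have hm2 : Measurable (fun q : ℝ × (Fin m → ℝ) => F (L (WithLp.toLp 2
      ((MeasurableEquiv.piFinSuccAbove (fun _ => ℝ) i).symm q)))) :=
    hm1.comp (MeasurableEquiv.measurable _)
  rw [Measure.volume_eq_prod, lintegral_prod _ hm2.aemeasurable]
  congr 1; ext s
  have h2 := (PiLp.volume_preserving_ofLp (Fin m)).lintegral_comp
    (f := fun y : Fin m → ℝ => F (L (WithLp.toLp 2 (i.insertNth (α := fun _ => ℝ) s y)))) (by
      apply (hF.comp L.continuous.measurable).comp
      apply Continuous.measurable
      apply (PiLp.continuous_toLp 2 _).comp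
      apply Continuous.finInsertNth
      · exact continuous_const
      · exact continuous_id)
  exact h2

/-- A shrinking sequence of bumps. -/
def bumpSeq (n : ℕ) (k : ℕ) : ContDiffBump (0 : Euc n) where
  rIn := 1 / (k + 1) / 2
  rOut := 1 / (k + 1)
  rIn_pos := by positivity
  rIn_lt_rOut := half_lt_self (by positivity)

theorem bumpSeq_tendsto (n : ℕ) :
    Filter.Tendsto (fun k => (bumpSeq n k).rOut) Filter.atTop (nhds 0) :=
  tendsto_one_div_add_atTop_nhds_zero_nat

theorem slice_scalar {m : ℕ} {p : ℝ} (hp1 : 1 < p) {Ω U : Set (Euc (m + 1))}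
    (hΩ : IsOpen Ω) (hU : IsOpen U) (hUΩ : U ⊆ Ω) {g : Euc (m + 1) → Euc (m + 1)}
    {Dg : Euc (m + 1) → Matrix (Fin (m + 1)) (Fin (m + 1)) ℝ}
    (hg : ContinuousOn g Ω) (hS : MemSobolev p Ω g Dg) (L : Euc (m + 1) ≃ₗᵢ[ℝ] Euc (m + 1))
    (i a : Fin (m + 1)) (s : ℝ) {Q : Set (Euc m)} (hQ : IsCompact Q)
    (hQU : ∀ x ∈ Q, L (ins i s x) ∈ U) {c : ℝ≥0∞} (hc : c < ⊤) {x y : Euc m} (hx : x ∈ Q) (hy : y ∈ Q)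
    (hM : ∀ G : Euc m → ℝ, ContDiff ℝ 1 G → ‖G x - G y‖ₑ ≤ c *
        (∫⁻ y in Q, ‖fderiv ℝ G y‖ₑ ^ p) ^ (1 / p)) :
    ‖g (L (ins i s x)) a - g (L (ins i s y)) a‖ₑ ≤ c * (Filter.liminf (fun k => ∫⁻ x : Euc m,
      (∫⁻ y, ENNReal.ofReal ((bumpSeq (m + 1) k).normed volume (L (ins i s x) - y)) *
        U.indicator (fun y => ENNReal.ofReal (opNorm (Dg y) ^ p)) y)) Filter.atTop) ^ (1 / p) := by
  have hp0 : 0 < p := by linarith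
  set S : Euc m → Euc (m + 1) := fun x => L (ins i s x) with hSdef
  have hScont : Continuous S := L.continuous.comp ((continuous_ins i).comp (by fun_prop : Continuous fun x : Euc m => (s, x)))
  have hSeq : S = fun x => L (ins i s 0) +
      (L.toLinearIsometry.comp (insLin i)).toContinuousLinearMap x := by
    funext z
    simp only [hSdef]
    rw [ins_eq, map_add]; rfl
  have hSd : ∀ x, HasFDerivAt S ((L.toLinearIsometry.comp (insLin i)).toContinuousLinearMap) x := by
    intro x
    have h1 := ((L.toLinearIsometry.comp (insLin i)).toContinuousLinearMap.hasFDerivAt (x := x)).const_add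
      (L (ins i s 0))
    rw [hSeq]; exact h1
  obtain ⟨η, hη, hKU⟩ := (hQ.image hScont).exists_cthickening_subset_open hU (by
    rintro _ ⟨x, hx, rfl⟩; exact hQU x hx)
  set K := cthickening η (S '' Q) with hK
  have hKc : IsCompact K := (hQ.image hScont).cthickening
  set gt : Euc (m + 1) → ℝ := K.indicator (fun y => g y a) with hgt
  have hgaC : ContinuousOn (fun y => g y a) Ω :=
    (EuclideanSpace.proj (𝕜 := ℝ) a).continuous.comp_continuousOn hg
  have hgtI : Integrable gt := by
    rw [hgt, integrable_indicator_iff hKc.measurableSet]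
    exact (hS.locInt a).integrableOn_compact_subset (hKU.trans hUΩ) hKc
  set T : ℕ → Euc (m + 1) → ℝ := fun k => convolution gt ((bumpSeq (m + 1) k).normed volume)
    (ContinuousLinearMap.lsmul ℝ ℝ) volume with hT
  have hTs : ∀ k, ContDiff ℝ 1 (T k) := fun k =>
    (bumpSeq (m + 1) k).hasCompactSupport_normed.contDiff_convolution_right _
      hgtI.locallyIntegrable ((bumpSeq (m + 1) k).contDiff_normed (n := 1))
  have hconv : ∀ x ∈ Q, Filter.Tendsto (fun k => T k (S x)) Filter.atTop (nhds (g (S x) a)) := by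
    intro x hx
    have hnh : K ∈ nhds (S x) := by
      refine Filter.mem_of_superset (ball_mem_nhds _ hη) ?_
      exact (ball_subset_closedBall).trans (closedBall_subset_cthickening (mem_image_of_mem _ hx) _)
    have hga : ContinuousAt gt (S x) := by
      have h1 : ContinuousAt (fun y => g y a) (S x) :=
        hgaC.continuousAt (hΩ.mem_nhds (hUΩ (hQU x hx)))
      refine h1.congr ?_
      filter_upwards [hnh] with y hy
      simp [hgt, hy]
    have hval : gt (S x) = g (S x) a := by simp [hgt, mem_of_mem_nhds hnh]
    have := ContDiffBump.convolution_tendsto_right (μ := (volume : Measure (Euc (m + 1))))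
      (φ := bumpSeq (m + 1)) (g := fun _ => gt)
      (k := fun _ => S x) (x₀ := S x) (z₀ := gt (S x)) (l := Filter.atTop) (bumpSeq_tendsto _)
      (Filter.Eventually.of_forall fun _ => hgtI.aestronglyMeasurable)
      (by
        have : (Function.uncurry fun (_ : ℕ) => gt) = gt ∘ Prod.snd := rfl
        rw [this]
        exact hga.tendsto.comp Filter.tendsto_snd) tendsto_const_nhds
    rw [hval] at this
    refine this.congr fun k => ?_
    rw [convolution_lsmul_swap, hT]
    simp only [convolution, ContinuousLinearMap.lsmul_apply, smul_eq_mul]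
    congr 1; ext t; ring
  have hlim : Filter.Tendsto (fun k => ‖T k (S x) - T k (S y)‖ₑ) Filter.atTop
      (nhds ‖g (S x) a - g (S y) a‖ₑ) := ((hconv x hx).sub (hconv y hy)).enorm
  have hev : ∀ᶠ k in Filter.atTop, ‖T k (S x) - T k (S y)‖ₑ ≤ c * (∫⁻ x : Euc m,
      (∫⁻ y, ENNReal.ofReal ((bumpSeq (m + 1) k).normed volume (S x - y)) *
        U.indicator (fun y => ENNReal.ofReal (opNorm (Dg y) ^ p)) y)) ^ (1 / p) := by
    filter_upwards [(bumpSeq_tendsto (m + 1)).eventually_lt_const hη] with k hk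
    have h1 := hM (fun x => T k (S x)) ((hTs k).comp (by
      rw [hSeq]
      exact contDiff_const.add (ContinuousLinearMap.contDiff _)))
    refine h1.trans ?_
    refine mul_le_mul_right (ENNReal.rpow_le_rpow ?_ (by positivity)) _
    refine (setLIntegral_mono' hQ.measurableSet (fun z hz => ?_)).trans (setLIntegral_le_lintegral _ _)
    have hsub : closedBall (S z) (bumpSeq (m + 1) k).rOut ⊆ K :=
      (closedBall_subset_closedBall hk.le).trans
        (closedBall_subset_cthickening (mem_image_of_mem _ hz) _)
    have h2 := mollify_deriv hp1 hΩ.measurableSet hS a hKc (hKU.trans hUΩ) (bumpSeq (m + 1) k) hsub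
      hU.measurableSet hUΩ (hsub.trans hKU)
    refine le_trans ?_ h2
    refine ENNReal.rpow_le_rpow ?_ hp0.le
    have h3 : HasFDerivAt (fun x => T k (S x)) _ z :=
      (((hTs k).differentiable (by norm_num)) (S z)).hasFDerivAt.comp z (hSd z)
    rw [h3.fderiv]
    refine (ContinuousLinearMap.opENorm_le_bound _ fun v => ?_)
    refine (ContinuousLinearMap.le_opENorm (fderiv ℝ (T k) (S z))
      ((L.toLinearIsometry.comp (insLin i)).toContinuousLinearMap v)).trans (le_of_eq ?_)
    congr 1
    rw [← ofReal_norm, ← ofReal_norm]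
    congr 1
    exact (L.toLinearIsometry.comp (insLin i)).norm_map v
  rw [← hlim.liminf_eq]
  refine (Filter.liminf_le_liminf hev).trans (le_of_eq ?_)
  have hmono : Monotone (fun t : ℝ≥0∞ => c * t ^ (1 / p)) := by
    intro u v huv
    dsimp only
    gcongr
  have hct : Continuous (fun t : ℝ≥0∞ => c * t ^ (1 / p)) :=
    (ENNReal.continuous_const_mul hc.ne).comp ENNReal.continuous_rpow_const
  exact (hmono.map_liminf_of_continuousAt _ hct.continuousAt).symm

theorem slice_osc (m : ℕ) {p : ℝ} (hp1 : 1 < p) (hp : (m : ℝ) < p) (K : ℝ) :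
    ∃ C : ℝ≥0∞, C < ⊤ ∧ ∀ (Ω U : Set (Euc (m + 1))) (g : Euc (m + 1) → Euc (m + 1))
      (Dg : Euc (m + 1) → Matrix (Fin (m + 1)) (Fin (m + 1)) ℝ), IsOpen Ω → IsOpen U → U ⊆ Ω →
      ContinuousOn g Ω → MemSobolev p Ω g Dg →
      ∀ (L : Euc (m + 1) ≃ₗᵢ[ℝ] Euc (m + 1)) (i : Fin (m + 1)), ∃ W : ℝ → ℝ≥0∞, Measurable W ∧
      ∫⁻ s, W s ≤ ∫⁻ y in U, ENNReal.ofReal (opNorm (Dg y) ^ p) ∧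
      ∀ (s : ℝ) (Q : Set (Euc m)), IsCompact Q → Convex ℝ Q → (∀ x ∈ Q, L (ins i s x) ∈ U) →
      ∀ (c : Euc m) (ρ : ℝ), 0 < ρ → closedBall c ρ ⊆ Q →
      (∀ y ∈ Q, ∀ x ∈ Q, ‖y - x‖ ≤ K * ρ) → ∀ x ∈ Q, ∀ y ∈ Q,
      ‖g (L (ins i s x)) - g (L (ins i s y))‖ₑ ≤
        C * ENNReal.ofReal (ρ ^ (1 - m / p)) * W s ^ (1 / p) := by
  obtain ⟨C, hC, hM⟩ := morrey_const m hp1 hp K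
  refine ⟨(m + 1 : ℕ) * C, ENNReal.mul_lt_top (by simp) hC, ?_⟩
  intro Ω U g Dg hΩ hU hUΩ hg hS L i
  set w : Euc (m + 1) → ℝ≥0∞ := U.indicator (fun y => ENNReal.ofReal (opNorm (Dg y) ^ p)) with hw
  have hwm : AEMeasurable w := by
    rw [hw, aemeasurable_indicator_iff hU.measurableSet]
    exact ((hS.lp.mono_set hUΩ).aemeasurable).ennreal_ofReal
  set w' := hwm.mk w with hw'
  have hw'm : Measurable w' := hwm.measurable_mk
  set V : ℕ → Euc (m + 1) → ℝ≥0∞ := fun k z =>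
    ∫⁻ y, ENNReal.ofReal ((bumpSeq (m + 1) k).normed volume (z - y)) * w y with hV
  have hVeq : ∀ k z, V k z =
      ∫⁻ y, ENNReal.ofReal ((bumpSeq (m + 1) k).normed volume (z - y)) * w' y := by
    intro k z
    apply lintegral_congr_ae
    filter_upwards [hwm.ae_eq_mk] with y hy
    rw [hy]
  have hbc : ∀ k, Continuous ((bumpSeq (m + 1) k).normed (volume : Measure (Euc (m + 1)))) :=
    fun k => (bumpSeq (m + 1) k).continuous_normed
  have hker : ∀ k, Measurable (fun q : Euc (m + 1) × Euc (m + 1) =>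
      ENNReal.ofReal ((bumpSeq (m + 1) k).normed volume (q.1 - q.2)) * w' q.2) := by
    intro k
    refine Measurable.mul ?_ (hw'm.comp measurable_snd)
    apply Measurable.ennreal_ofReal
    exact ((hbc k).comp (continuous_fst.sub continuous_snd)).measurable
  have hVm : ∀ k, Measurable (V k) := by
    intro k
    have : V k = fun z => ∫⁻ y, ENNReal.ofReal ((bumpSeq (m + 1) k).normed volume (z - y)) * w' y :=
      funext (hVeq k)
    rw [this]
    exact (hker k).lintegral_prod_right'
  have hVint : ∀ k, ∫⁻ z, V k z = ∫⁻ y in U, ENNReal.ofReal (opNorm (Dg y) ^ p) := by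
    intro k
    simp_rw [hVeq]
    rw [lintegral_lintegral_swap (hker k).aemeasurable]
    have h1 : ∀ y, ∫⁻ z, ENNReal.ofReal ((bumpSeq (m + 1) k).normed volume (z - y)) * w' y = w' y := by
      intro y
      rw [lintegral_mul_const _ (by have := hbc k; fun_prop),
        lintegral_sub_right_eq_self (fun z => ENNReal.ofReal ((bumpSeq (m + 1) k).normed volume z)) y,
        ← ofReal_integral_eq_lintegral_ofReal (bumpSeq (m + 1) k).integrable_normed
          (Filter.Eventually.of_forall (bumpSeq (m + 1) k).nonneg_normed),
        (bumpSeq (m + 1) k).integral_normed]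
      simp
    simp_rw [h1]
    rw [← lintegral_congr_ae hwm.ae_eq_mk, hw, lintegral_indicator hU.measurableSet]
  have hIm : ∀ k, Measurable (fun s => ∫⁻ x : Euc m, V k (L (ins i s x))) := by
    intro k
    have : Measurable (fun q : ℝ × Euc m => V k (L (ins i q.1 q.2))) :=
      (hVm k).comp (L.continuous.comp (continuous_ins i)).measurable
    exact this.lintegral_prod_right'
  refine ⟨fun s => Filter.liminf (fun k => ∫⁻ x : Euc m, V k (L (ins i s x))) Filter.atTop,
    Measurable.liminf hIm, ?_, ?_⟩
  · refine (lintegral_liminf_le hIm).trans ?_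
    simp_rw [fun k => tonelli_ins L i (hVm k), hVint]
    simp
  · intro s Q hQ hQc hQU c ρ hρ hcQ hd x hx y hy
    have hcomp : ∀ a : Fin (m + 1), ‖g (L (ins i s x)) a - g (L (ins i s y)) a‖ₑ ≤
        C * ENNReal.ofReal (ρ ^ (1 - m / p)) * (Filter.liminf (fun k => ∫⁻ x : Euc m,
          V k (L (ins i s x))) Filter.atTop) ^ (1 / p) := by
      intro a
      exact slice_scalar hp1 hΩ hU hUΩ hg hS L i a s hQ hQU
        (ENNReal.mul_lt_top hC (by simp)) hx hy
        (fun G hG => hM G hG Q hQ hQc c ρ hρ hcQ hd x hx y hy)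
    have hsum : ∀ v : Euc (m + 1), ‖v‖ₑ ≤ ∑ a, ‖v a‖ₑ := by
      intro v
      have hv : v = ∑ j, v j • (EuclideanSpace.single j (1 : ℝ) : Euc (m + 1)) := by
        ext i
        simp [Finset.sum_apply, Pi.single_apply]
      conv_lhs => rw [hv]
      refine (enorm_sum_le _ _).trans (le_of_eq ?_)
      apply Finset.sum_congr rfl
      intro j _
      rw [enorm_smul, ← ofReal_norm (EuclideanSpace.single j (1:ℝ) : Euc (m+1))]
      simp
    refine (hsum _).trans ((Finset.sum_le_sum fun a _ => hcomp a).trans (le_of_eq ?_))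
    simp only [Finset.sum_const, Finset.card_univ, Fintype.card_fin, nsmul_eq_mul]
    ring

theorem cuspFun_pos_eq {α t : ℝ} (ht : 0 < t) : cuspFun α t = Real.exp (1 - t ^ (-α)) := by
  rw [cuspFun, if_pos ht, Real.exp_sub]

theorem cuspFun_pos {α t : ℝ} (ht : 0 < t) : 0 < cuspFun α t := by
  rw [cuspFun_pos_eq ht]; positivity

theorem cuspFun_nonneg (α t : ℝ) : 0 ≤ cuspFun α t := by
  rcases lt_or_ge 0 t with h | h
  · exact (cuspFun_pos h).le
  · rw [cuspFun, if_neg h.not_gt]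

theorem cuspFun_mono {α : ℝ} (hα : 0 < α) : Monotone (cuspFun α) := by
  intro s t hst
  rcases lt_or_ge 0 s with h | h
  · rw [cuspFun_pos_eq h, cuspFun_pos_eq (h.trans_le hst)]
    apply Real.exp_le_exp.2
    have := Real.rpow_le_rpow_of_nonpos h hst (by linarith : -α ≤ 0)
    linarith
  · have : cuspFun α s = 0 := by rw [cuspFun, if_neg h.not_gt]
    rw [this]; exact cuspFun_nonneg _ _

theorem cuspFun_le {α t : ℝ} (hα : 3 ≤ α) (ht : 0 < t) (ht1 : t ≤ 1) : cuspFun α t ≤ t ^ 3 := by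
  rw [cuspFun_pos_eq ht]
  have hX : 0 < t ^ (-α) := by positivity
  have h1 : Real.exp (1 - t ^ (-α)) ≤ (t ^ (-α))⁻¹ := by
    rw [show 1 - t ^ (-α) = -(t ^ (-α) - 1) by ring, Real.exp_neg]
    apply inv_anti₀ hX
    have := Real.add_one_le_exp (t ^ (-α) - 1)
    linarith
  refine h1.trans ?_
  rw [Real.rpow_neg ht.le, inv_inv, ← Real.rpow_natCast]
  exact Real.rpow_le_rpow_of_exponent_ge ht ht1 (by simpa using hα)

theorem cuspFun_continuous {α : ℝ} (hα : 3 ≤ α) : Continuous (cuspFun α) := by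
  rw [continuous_iff_continuousAt]
  intro t
  rcases lt_trichotomy t 0 with h | h | h
  · have : cuspFun α =ᶠ[nhds t] fun _ => 0 := by
      filter_upwards [Iio_mem_nhds h] with s hs
      rw [cuspFun, if_neg (not_lt.2 (le_of_lt hs))]
    exact continuousAt_const.congr this.symm
  · subst h
    have h0 : cuspFun α 0 = 0 := by simp [cuspFun]
    rw [ContinuousAt, h0]
    have hlim : Filter.Tendsto (fun t : ℝ => |t| ^ 3) (nhds 0) (nhds 0) := by
      have : Continuous (fun t : ℝ => |t| ^ 3) := by fun_prop
      simpa using this.tendsto 0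
    refine tendsto_of_tendsto_of_tendsto_of_le_of_le' tendsto_const_nhds hlim
      (Filter.Eventually.of_forall fun s => cuspFun_nonneg _ _) ?_
    filter_upwards [Iio_mem_nhds (show (0:ℝ) < 1 by norm_num)] with s hs
    rcases lt_or_ge 0 s with h | h
    · have := cuspFun_le hα h (le_of_lt hs)
      rwa [abs_of_pos h]
    · rw [cuspFun, if_neg h.not_gt]; positivity
  · have : cuspFun α =ᶠ[nhds t] fun t => Real.exp (1 - t ^ (-α)) := by
      filter_upwards [Ioi_mem_nhds h] with s hs
      exact cuspFun_pos_eq hs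
    refine ContinuousAt.congr ?_ this.symm
    have h1 : ContinuousAt (fun t : ℝ => t ^ (-α)) t := Real.continuousAt_rpow_const t (-α) (Or.inl h.ne')
    exact (continuousAt_const.sub h1).rexp

/-- The last coordinates. -/
def tl {m : ℕ} (y : Euc (m + 1)) : Euc m := WithLp.toLp 2 (fun j => y j.succ)

@[simp] theorem tl_apply {m : ℕ} (y : Euc (m + 1)) (j : Fin m) : tl y j = y j.succ := rfl

theorem ins_succ {m : ℕ} (s : ℝ) (x : Euc m) (j : Fin m) : ins 0 s x j.succ = x j := by
  have := ins_succAbove 0 s x j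
  rwa [Fin.zero_succAbove] at this

@[simp] theorem tl_ins {m : ℕ} (s : ℝ) (x : Euc m) : tl (ins 0 s x) = x := by
  ext j
  rw [tl_apply, ins_succ]

theorem ins_tl {m : ℕ} (y : Euc (m + 1)) : ins 0 (y 0) (tl y) = y :=
  ins_ext 0 (by simp) (by simp [ins_succ])

theorem continuous_coord {m : ℕ} (i : Fin m) : Continuous (fun y : Euc m => y i) :=
  (EuclideanSpace.proj (𝕜 := ℝ) i).continuous

theorem continuous_tl {m : ℕ} : Continuous (tl : Euc (m + 1) → Euc m) :=
  (PiLp.continuous_toLp 2 _).comp (continuous_pi fun _ => continuous_coord _)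

theorem norm_sq_tl {m : ℕ} (y : Euc (m + 1)) : ‖y‖ ^ 2 = (y 0) ^ 2 + ‖tl y‖ ^ 2 := by
  conv_lhs => rw [← ins_tl y]
  exact norm_ins_sq _ _ _

theorem mem_cusp {m : ℕ} {u : ℝ → ℝ} (y : Euc (m + 1)) :
    y ∈ cuspBall (m + 1) u ↔ ‖y‖ < 1 ∧ (y 0 < 0 ∨ u (y 0) < ‖tl y‖) := by
  have h : Real.sqrt (∑ i ∈ Finset.univ.erase (0 : Fin (m + 1)), y i ^ 2) = ‖tl y‖ := by
    rw [EuclideanSpace.norm_eq]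
    congr 1
    have := Fin.sum_univ_succ (fun i => y i ^ 2)
    rw [← Finset.add_sum_erase _ _ (Finset.mem_univ (0 : Fin (m + 1)))] at this
    have h2 := add_left_cancel this
    rw [h2]
    simp
  simp only [cuspBall, mem_sdiff, mem_ball_zero_iff, mem_ofPred_eq, h, not_and_or, not_le]

theorem isOpen_cusp {m : ℕ} {u : ℝ → ℝ} (hu : Continuous u) : IsOpen (cuspBall (m + 1) u) := by
  have : cuspBall (m + 1) u = {y | ‖y‖ < 1} ∩ ({y | y 0 < 0} ∪ {y | u (y 0) < ‖tl y‖}) := by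
    ext y
    rw [mem_cusp]; rfl
  rw [this]
  refine (isOpen_lt continuous_norm continuous_const).inter
    ((isOpen_lt (continuous_coord 0) continuous_const).union
      (isOpen_lt (hu.comp (continuous_coord 0)) (continuous_norm.comp continuous_tl)))

theorem ring_step {m : ℕ} {a : ℝ} (ha : 0 < a) {ω ω' : Euc m} (h1 : ‖ω‖ = 1) (h2 : ‖ω'‖ = 1)
    (hi : 0 ≤ inner ℝ ω ω') :
    closedBall (a • (ω + ω')) a ⊆ {x : Euc m | a / 3 < ‖x‖ ∧ ‖x‖ ≤ 3 * a} ∧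
      a • ω ∈ closedBall (a • (ω + ω')) a ∧ a • ω' ∈ closedBall (a • (ω + ω')) a := by
  have hsq : ‖ω + ω'‖ ^ 2 = 2 + 2 * inner ℝ ω ω' := by
    rw [norm_add_sq_real, h1, h2]; ring
  have hlow : 4 / 3 < ‖ω + ω'‖ := by
    by_contra hc
    push Not at hc
    nlinarith [norm_nonneg (ω + ω')]
  have hup : ‖ω + ω'‖ ≤ 2 := (norm_add_le _ _).trans (by rw [h1, h2]; norm_num)
  refine ⟨?_, ?_, ?_⟩
  · intro x hx
    rw [mem_closedBall, dist_eq_norm] at hx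
    have hn : ‖a • (ω + ω')‖ = a * ‖ω + ω'‖ := by rw [norm_smul, Real.norm_of_nonneg ha.le]
    have e1 : ‖a • (ω + ω')‖ ≤ ‖x‖ + ‖x - a • (ω + ω')‖ := by
      have := norm_sub_le x (x - a • (ω + ω'))
      simpa using this
    have e2 : ‖x‖ ≤ ‖a • (ω + ω')‖ + ‖x - a • (ω + ω')‖ := by
      have := norm_add_le (a • (ω + ω')) (x - a • (ω + ω'))
      simpa using this
    rw [hn] at e1 e2
    constructor <;> nlinarith
  · rw [mem_closedBall, dist_eq_norm, ← smul_sub, norm_smul, Real.norm_of_nonneg ha.le]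
    simp [h2]
  · rw [mem_closedBall, dist_eq_norm, ← smul_sub, norm_smul, Real.norm_of_nonneg ha.le]
    simp [h1]

theorem ring_chain {m k : ℕ} {a : ℝ} (ha : 0 < a) {e₁ e₂ : Euc m} (h1 : ‖e₁‖ = 1) (h2 : ‖e₂‖ = 1)
    (h12 : inner ℝ e₂ e₁ = 0) (G : Euc m → Euc k) (D : ℝ≥0∞)
    (hG : ∀ c, closedBall c a ⊆ {x : Euc m | a / 3 < ‖x‖ ∧ ‖x‖ ≤ 3 * a} →
      ∀ x ∈ closedBall c a, ∀ y ∈ closedBall c a, ‖G x - G y‖ₑ ≤ D)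
    {x : Euc m} (hx : a / 3 < ‖x‖) (hx' : ‖x‖ ≤ a) : ‖G x - G (a • e₁)‖ₑ ≤ 3 * D := by
  have hxp : 0 < ‖x‖ := by linarith
  set ω : Euc m := ‖x‖⁻¹ • x with hω
  have hω1 : ‖ω‖ = 1 := by rw [hω, norm_smul, norm_inv, norm_norm, inv_mul_cancel₀ hxp.ne']
  have hxω : x = ‖x‖ • ω := by rw [hω, smul_smul, mul_inv_cancel₀ hxp.ne', one_smul]
  have s1 : ‖G x - G (a • ω)‖ₑ ≤ D := by
    refine hG (x + a • ω) ?_ x ?_ (a • ω) ?_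
    · intro y hy
      rw [mem_closedBall, dist_eq_norm] at hy
      have hn : ‖x + a • ω‖ = ‖x‖ + a := by
        conv_lhs => rw [hxω]
        rw [← add_smul, norm_smul, hω1, mul_one, Real.norm_of_nonneg (by positivity)]
      have e1 : ‖x + a • ω‖ ≤ ‖y‖ + ‖y - (x + a • ω)‖ := by
        have := norm_sub_le y (y - (x + a • ω))
        simpa using this
      have e2 : ‖y‖ ≤ ‖x + a • ω‖ + ‖y - (x + a • ω)‖ := by
        have := norm_add_le (x + a • ω) (y - (x + a • ω))
        simpa using this
      constructor <;> linarith
    · rw [mem_closedBall, dist_eq_norm]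
      simp [norm_smul, hω1, abs_of_pos ha]
    · rw [mem_closedBall, dist_eq_norm]
      simpa using hx'
  obtain ⟨e₃, h3, hi3, hi31⟩ : ∃ e₃ : Euc m, ‖e₃‖ = 1 ∧ 0 ≤ inner ℝ ω e₃ ∧ inner ℝ e₃ e₁ = 0 := by
    rcases le_total 0 (inner ℝ ω e₂) with h | h
    · exact ⟨e₂, h2, h, h12⟩
    · exact ⟨-e₂, by simpa using h2, by rw [inner_neg_right]; linarith,
        by rw [inner_neg_left, h12, neg_zero]⟩
  obtain ⟨p1, p2, p3⟩ := ring_step ha hω1 h3 hi3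
  have s2 := hG _ p1 _ p2 _ p3
  obtain ⟨q1, q2, q3⟩ := ring_step ha h3 h1 hi31.ge
  have s3 := hG _ q1 _ q2 _ q3
  have : G x - G (a • e₁) = (G x - G (a • ω)) + (G (a • ω) - G (a • e₃)) +
    (G (a • e₃) - G (a • e₁)) := by abel
  rw [this]
  calc _ ≤ D + D + D := (enorm_add_le _ _).trans
          (add_le_add ((enorm_add_le _ _).trans (add_le_add s1 s2)) s3)
    _ = 3 * D := by ring

theorem lintegral_pick {W : ℝ → ℝ≥0∞} {E : ℝ} (hE : 0 ≤ E)
    (hW : ∫⁻ s, W s ≤ ENNReal.ofReal E) {a b : ℝ} (hab : a < b) :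
    ∃ t ∈ Ioo a b, W t ≤ ENNReal.ofReal ((E + 1) / (b - a)) := by
  by_contra hc
  push Not at hc
  have hba : 0 < b - a := by linarith
  have h1 : ∫⁻ s in Ioo a b, ENNReal.ofReal ((E + 1) / (b - a)) ≤ ∫⁻ s, W s :=
    (setLIntegral_mono' measurableSet_Ioo fun s hs => (hc s hs).le).trans
      (setLIntegral_le_lintegral _ _)
  rw [setLIntegral_const, Real.volume_Ioo, ← ENNReal.ofReal_mul (by positivity),
    div_mul_cancel₀ _ hba.ne'] at h1
  have := (ENNReal.ofReal_le_ofReal_iff hE).1 (h1.trans hW)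
  linarith

theorem exp_beats {A β : ℝ} (hβ : 0 < β) :
    ∀ᶠ X : ℝ in Filter.atTop, A * X * Real.exp (-β * X) ≤ Real.exp (-(β / 2) * X) := by
  have h1 : Filter.Tendsto (fun X : ℝ => A * (2 / β) * ((β / 2 * X) ^ 1 * Real.exp (-(β / 2 * X))))
      Filter.atTop (nhds (A * (2 / β) * 0)) :=
    ((Real.tendsto_pow_mul_exp_neg_atTop_nhds_zero 1).comp
      (Filter.tendsto_id.const_mul_atTop (by positivity : 0 < β / 2))).const_mul _
  rw [mul_zero] at h1
  filter_upwards [h1.eventually_lt_const (show (0:ℝ) < 1 by norm_num)] with X hX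
  have h2 : A * (2 / β) * ((β / 2 * X) ^ 1 * Real.exp (-(β / 2 * X))) =
      A * X * Real.exp (-(β / 2 * X)) := by field_simp
  rw [h2] at hX
  have h3 : Real.exp (-β * X) = Real.exp (-(β / 2 * X)) * Real.exp (-(β / 2) * X) := by
    rw [← Real.exp_add]; congr 1; ring
  rw [h3, ← mul_assoc]
  nlinarith [Real.exp_pos (-(β / 2) * X)]

theorem osc_f {m : ℕ} {α p : ℝ} (hα : 3 ≤ α) (hp1 : 1 < p) (hp : (m : ℝ) < p)
    {e₁ e₂ : Euc m} (h1 : ‖e₁‖ = 1) (h2 : ‖e₂‖ = 1) (h12 : inner ℝ e₂ e₁ = 0)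
    {f : Euc (m + 1) → Euc (m + 1)} {Df : Euc (m + 1) → Matrix (Fin (m + 1)) (Fin (m + 1)) ℝ}
    (hf : ContinuousOn f (cuspBall (m + 1) (cuspFun α)))
    (hS : MemSobolev p (cuspBall (m + 1) (cuspFun α)) f Df) :
    ∃ c > 0, ∀ᶠ τ in nhdsWithin (0 : ℝ) (Ioi 0), ∃ t ∈ Ioo (τ / 2) τ, ∀ x : Euc m,
      cuspFun α t < ‖x‖ → ‖x‖ ≤ 3 * cuspFun α t →
      ‖f (ins 0 t x) - f (ins 0 t ((3 * cuspFun α t) • e₁))‖ ≤ Real.exp (-c * τ ^ (-α)) := by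
  have hp0 : 0 < p := by linarith
  obtain ⟨C, hC, hO⟩ := slice_osc m hp1 hp 2
  have hΩ := isOpen_cusp (m := m) (cuspFun_continuous hα)
  obtain ⟨W, hWm, hWi, hWo⟩ := hO _ _ f Df hΩ hΩ subset_rfl hf hS (LinearIsometryEquiv.refl ℝ _) 0
  set β : ℝ := 1 - m / p with hβdef
  have hβ : 0 < β := by
    rw [hβdef, sub_pos, div_lt_one hp0]; exact hp
  set E : ℝ := (∫⁻ y in cuspBall (m + 1) (cuspFun α), ENNReal.ofReal (opNorm (Df y) ^ p)).toReal with hE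
  have hEfin : ∫⁻ y in cuspBall (m + 1) (cuspFun α), ENNReal.ofReal (opNorm (Df y) ^ p) ≠ ⊤ :=
    hS.lp.lintegral_lt_top.ne
  have hE0 : 0 ≤ E := ENNReal.toReal_nonneg
  have hWE : ∫⁻ s, W s ≤ ENNReal.ofReal E := by
    rw [hE, ENNReal.ofReal_toReal hEfin]; exact hWi
  set A : ℝ := 3 * C.toReal * (3 * Real.exp 1) ^ β * (2 * (E + 1)) ^ (1 / p) with hA
  refine ⟨β / 2, by positivity, ?_⟩
  have hX : Filter.Tendsto (fun τ : ℝ => τ ^ (-α)) (nhdsWithin 0 (Ioi 0)) Filter.atTop :=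
    tendsto_rpow_neg_nhdsGT_zero (by linarith)
  filter_upwards [hX.eventually (exp_beats (A := A) hβ), self_mem_nhdsWithin,
    Ioo_mem_nhdsGT (show (0:ℝ) < 1 / 8 by norm_num)] with τ hτ hτ0 hτ8
  simp only [mem_Ioi] at hτ0
  obtain ⟨t, ht, hWt⟩ := lintegral_pick hE0 hWE (show τ / 2 < τ by linarith)
  refine ⟨t, ht, fun x hx hx' => ?_⟩
  have ht0 : 0 < t := by linarith [ht.1]
  have htτ : t < τ := ht.2
  have ht8 : t < 1 / 8 := ht.2.trans hτ8.2
  set u := cuspFun α t with hu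
  have hu0 : 0 < u := cuspFun_pos ht0
  have hut : u ≤ t ^ 3 := cuspFun_le hα ht0 (by linarith)
  have hut' : u ≤ 1 / 64 := by
    have : t ^ 3 ≤ (1 / 8) ^ 3 := by gcongr
    norm_num at this ⊢; linarith
  have hmem : ∀ z : Euc m, u < ‖z‖ → ‖z‖ ≤ 9 * u → ins 0 t z ∈ cuspBall (m + 1) (cuspFun α) := by
    intro z hz hz'
    rw [mem_cusp]
    refine ⟨?_, Or.inr (by simpa using hz)⟩
    have := norm_ins_sq 0 t z
    nlinarith [norm_nonneg (ins 0 t z), norm_nonneg z]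
  have hfin := ring_chain (a := 3 * u) (by positivity) h1 h2 h12 (fun z => f (ins 0 t z))
    (C * ENNReal.ofReal ((3 * u) ^ β) * W t ^ (1 / p)) (by
      intro c hc y hy z hz
      refine hWo t (closedBall c (3 * u)) (isCompact_closedBall _ _) (convex_closedBall _ _) ?_ c
        (3 * u) (by positivity) subset_rfl ?_ y hy z hz
      · intro w hw
        have := hc hw
        exact hmem w (by linarith [this.1]) (by linarith [this.2])
      · intro w hw v hv
        rw [mem_closedBall] at hw hv
        rw [← dist_eq_norm]
        have := dist_triangle_right w v c
        linarith) (x := x) (by linarith) hx'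
  have hb : 3 * (C * ENNReal.ofReal ((3 * u) ^ β) * W t ^ (1 / p)) ≤
      ENNReal.ofReal (3 * (C.toReal * (3 * u) ^ β * ((E + 1) / (τ - τ / 2)) ^ (1 / p))) := by
    have hq : 0 ≤ (E + 1) / (τ - τ / 2) := div_nonneg (by linarith) (by linarith)
    rw [ENNReal.ofReal_mul (by norm_num), ENNReal.ofReal_mul (by positivity),
      ENNReal.ofReal_mul (by positivity), ENNReal.ofReal_toReal hC.ne,
      ← ENNReal.ofReal_rpow_of_nonneg hq (by positivity)]
    have : ENNReal.ofReal 3 = 3 := by simp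
    rw [this]
    gcongr
  have hreal : ‖f (ins 0 t x) - f (ins 0 t ((3 * u) • e₁))‖ ≤
      3 * (C.toReal * (3 * u) ^ β * ((E + 1) / (τ - τ / 2)) ^ (1 / p)) := by
    have := hfin.trans hb
    rw [← ofReal_norm] at this
    refine (ENNReal.ofReal_le_ofReal_iff ?_).1 this
    have hq : 0 ≤ (E + 1) / (τ - τ / 2) := div_nonneg (by linarith) (by linarith)
    positivity
  refine hreal.trans (le_trans ?_ hτ)
  have hu1 : (3 * u) ^ β ≤ (3 * Real.exp 1) ^ β * Real.exp (-β * τ ^ (-α)) := by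
    have : 3 * u ≤ 3 * Real.exp 1 * Real.exp (-τ ^ (-α)) := by
      rw [hu, cuspFun_pos_eq ht0, sub_eq_add_neg, Real.exp_add, mul_assoc]
      have := Real.rpow_le_rpow_of_nonpos ht0 htτ.le (by linarith : -α ≤ 0)
      gcongr
    refine (Real.rpow_le_rpow (by positivity) this hβ.le).trans (le_of_eq ?_)
    rw [Real.mul_rpow (by positivity) (by positivity), ← Real.exp_mul]
    congr 2; ring
  have hu2 : ((E + 1) / (τ - τ / 2)) ^ (1 / p) ≤ (2 * (E + 1)) ^ (1 / p) * τ ^ (-α) := by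
    have e1 : (E + 1) / (τ - τ / 2) = 2 * (E + 1) * τ⁻¹ := by
      field_simp; ring
    rw [e1, Real.mul_rpow (by positivity) (by positivity), ← Real.rpow_neg_one τ,
      ← Real.rpow_mul hτ0.le]
    refine mul_le_mul_of_nonneg_left ?_ (by positivity)
    apply Real.rpow_le_rpow_of_exponent_ge hτ0 (by linarith [hτ8.2])
    have : 1 / p ≤ 1 := by rw [div_le_one hp0]; exact hp1.le
    linarith
  have hq : 0 ≤ (E + 1) / (τ - τ / 2) := div_nonneg (by linarith) (by linarith)
  have hq' := Real.rpow_nonneg hq (1 / p)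
  calc _ ≤ 3 * (C.toReal * ((3 * Real.exp 1) ^ β * Real.exp (-β * τ ^ (-α))) *
        ((2 * (E + 1)) ^ (1 / p) * τ ^ (-α))) := by gcongr
    _ = _ := by rw [hA]; ring

/-- A coordinate box. -/
def box {k : ℕ} (e : Euc k) (r : ℝ) : Set (Euc k) := {x | ∀ i, |x i - e i| ≤ r}

theorem box_closed {k : ℕ} (e : Euc k) (r : ℝ) : IsClosed (box e r) := by
  have : box e r = ⋂ i, {x | |x i - e i| ≤ r} := by
    ext x; simp [box]
  rw [this]
  exact isClosed_iInter fun i =>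
    isClosed_le (((continuous_coord i).sub continuous_const).abs) continuous_const

theorem box_convex {k : ℕ} (e : Euc k) (r : ℝ) : Convex ℝ (box e r) := by
  intro x hx y hy a b ha hb hab i
  have h1 := hx i
  have h2 := hy i
  have : (a • x + b • y) i - e i = a * (x i - e i) + b * (y i - e i) := by
    simp only [PiLp.add_apply, PiLp.smul_apply, smul_eq_mul]
    linear_combination (e i) * hab
  rw [this]
  calc _ ≤ |a * (x i - e i)| + |b * (y i - e i)| := abs_add_le _ _
    _ = a * |x i - e i| + b * |y i - e i| := by rw [abs_mul, abs_mul, abs_of_nonneg ha, abs_of_nonneg hb]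
    _ ≤ a * r + b * r := by gcongr
    _ = r := by rw [← add_mul, hab, one_mul]

theorem norm_le_of_coord {k : ℕ} {v : Euc k} {r : ℝ} (hr : 0 ≤ r) (h : ∀ i, |v i| ≤ r) :
    ‖v‖ ^ 2 ≤ k * r ^ 2 ∧ ‖v‖ ≤ k * r := by
  have h1 : ‖v‖ ^ 2 ≤ k * r ^ 2 := by
    rw [EuclideanSpace.norm_sq_eq]
    calc _ ≤ ∑ _i : Fin k, r ^ 2 := Finset.sum_le_sum fun i _ => by
            have := h i
            rw [Real.norm_eq_abs]
            gcongr
      _ = _ := by simp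
  refine ⟨h1, ?_⟩
  rcases Nat.eq_zero_or_pos k with hk | hk
  · subst hk
    simp at h1 ⊢
    exact h1
  · refine abs_le_of_sq_le_sq' ?_ (by positivity) |>.2
    have : (1:ℝ) ≤ k := by exact_mod_cast hk
    have e : (k * r) ^ 2 - k * r ^ 2 = (k * (k - 1)) * r ^ 2 := by ring
    have : 0 ≤ (k * ((k:ℝ) - 1)) * r ^ 2 :=
      mul_nonneg (mul_nonneg (by positivity) (by linarith)) (by positivity)
    linarith

/-- The properties of a slice-energy function used below. -/
def SliceProp (d : ℕ) (C : ℝ≥0∞) (U : Set (Euc (d + 2))) (G : Euc (d + 2) → Euc (d + 2))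
    (i : Fin (d + 2)) (W : ℝ → ℝ≥0∞) : Prop :=
  ∀ (s : ℝ) (Q : Set (Euc (d + 1))), IsCompact Q → Convex ℝ Q → (∀ x ∈ Q, ins i s x ∈ U) →
      ∀ (c : Euc (d + 1)) (ρ : ℝ), 0 < ρ → closedBall c ρ ⊆ Q →
      (∀ y ∈ Q, ∀ x ∈ Q, ‖y - x‖ ≤ (8 * ((d + 1 : ℕ) : ℝ)) * ρ) → ∀ x ∈ Q, ∀ y ∈ Q,
      ‖G (ins i s x) - G (ins i s y)‖ₑ ≤
        C * ENNReal.ofReal (ρ ^ (1 / ((d + 2 : ℕ) : ℝ))) * W s ^ (1 / ((d + 2 : ℕ) : ℝ))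

theorem face_osc {d : ℕ} {C : ℝ≥0∞} {U : Set (Euc (d + 2))} {G : Euc (d + 2) → Euc (d + 2)}
    {i : Fin (d + 2)} {W : ℝ → ℝ≥0∞} (hW : SliceProp d C U G i W) (s : ℝ) {r R : ℝ} (hr : 0 < r)
    (e c : Euc (d + 1)) (hc : ‖c‖ + r / 4 ≤ R) (hce : ∀ j, |c j - e j| ≤ 3 * r / 4)
    (hU : ∀ x, ‖x‖ ≤ R → x ∈ box e r → ins i s x ∈ U)
    {x y : Euc (d + 1)} (hx : ‖x‖ ≤ R) (hx' : x ∈ box e r) (hy : ‖y‖ ≤ R) (hy' : y ∈ box e r) :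
    ‖G (ins i s x) - G (ins i s y)‖ₑ ≤ C * ENNReal.ofReal ((r / 4) ^ (1 / ((d + 2 : ℕ) : ℝ))) *
      W s ^ (1 / ((d + 2 : ℕ) : ℝ)) := by
  refine hW s (closedBall 0 R ∩ box e r) ((isCompact_closedBall _ _).inter_right (box_closed _ _))
    ((convex_closedBall _ _).inter (box_convex _ _)) ?_ c (r / 4) (by positivity) ?_ ?_ x
    ⟨by simpa using hx, hx'⟩ y ⟨by simpa using hy, hy'⟩
  · rintro z ⟨hz, hz'⟩
    exact hU z (by simpa using hz) hz'
  · intro z hz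
    rw [mem_closedBall, dist_eq_norm] at hz
    refine ⟨?_, fun j => ?_⟩
    · rw [mem_closedBall_zero_iff]
      have := norm_add_le c (z - c)
      rw [add_sub_cancel] at this
      linarith
    · have h1 := (PiLp.norm_apply_le (z - c) j).trans hz
      rw [Real.norm_eq_abs, PiLp.sub_apply] at h1
      have := abs_add_le (z j - c j) (c j - e j)
      rw [sub_add_sub_cancel] at this
      linarith [hce j]
  · rintro z ⟨-, hz⟩ w ⟨-, hw⟩
    have := (norm_le_of_coord (v := z - w) (r := 2 * r) (by positivity) (fun j => by
      rw [PiLp.sub_apply]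
      have h1 := hz j
      have h2 := hw j
      rw [abs_le] at h1 h2 ⊢
      constructor <;> linarith)).2
    refine this.trans (le_of_eq ?_)
    ring

/-- Sup-norm distance to `e₀`. -/
def cubeN {k : ℕ} (v : Euc (k + 1)) : ℝ := ‖WithLp.ofLp (v - EuclideanSpace.single 0 1)‖

theorem continuous_cubeN {k : ℕ} : Continuous (cubeN : Euc (k + 1) → ℝ) :=
  continuous_norm.comp ((PiLp.continuous_ofLp 2 _).comp (continuous_id.sub continuous_const))

theorem cubeN_coord {k : ℕ} (v : Euc (k + 1)) : |v 0 - 1| ≤ cubeN v ∧ ∀ j : Fin k, |v j.succ| ≤ cubeN v := by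
  constructor
  · have := norm_le_pi_norm (WithLp.ofLp (v - EuclideanSpace.single 0 1)) 0
    simpa [cubeN] using this
  · intro j
    have := norm_le_pi_norm (WithLp.ofLp (v - EuclideanSpace.single 0 1)) j.succ
    simpa [cubeN] using this

theorem cubeN_lt {k : ℕ} {v : Euc (k + 1)} {r : ℝ} (hr : 0 < r) (h0 : |v 0 - 1| < r)
    (h : ∀ j : Fin k, |v j.succ| < r) : cubeN v < r := by
  rw [cubeN, pi_norm_lt_iff hr]
  intro i
  refine Fin.cases ?_ (fun j => ?_) i
  · simpa using h0
  · simpa using h j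

theorem cubeN_le {k : ℕ} (v : Euc (k + 1)) : cubeN v ≤ ‖v - EuclideanSpace.single 0 1‖ := by
  rw [cubeN, pi_norm_le_iff_of_nonneg (norm_nonneg _)]
  intro i
  exact PiLp.norm_apply_le (v - EuclideanSpace.single 0 1) i

/-- Remove a coordinate. -/
def rmc {m : ℕ} (i : Fin (m + 1)) (y : Euc (m + 1)) : Euc m :=
  WithLp.toLp 2 (fun j => y (i.succAbove j))

@[simp] theorem rmc_apply {m : ℕ} (i : Fin (m + 1)) (y : Euc (m + 1)) (j : Fin m) :
    rmc i y j = y (i.succAbove j) := rfl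

theorem ins_rmc {m : ℕ} (i : Fin (m + 1)) (y : Euc (m + 1)) : ins i (y i) (rmc i y) = y :=
  ins_ext i (by simp) (by simp)

theorem cube_osc {d : ℕ} {C D : ℝ≥0∞} {G : Euc (d + 2) → Euc (d + 2)} {b r : ℝ}
    {W : Fin (d + 2) → ℝ → ℝ≥0∞}
    (hW : ∀ i, SliceProp d C {y | 1 - b < ‖y‖ ∧ ‖y‖ < 1} G i (W i))
    (hr : 0 < r) (hrb : r < b) (hrd : r * (d + 2 : ℕ) ≤ 1)
    (hD0 : C * ENNReal.ofReal ((r / 4) ^ (1 / ((d + 2 : ℕ) : ℝ))) *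
      W 0 (1 - r) ^ (1 / ((d + 2 : ℕ) : ℝ)) ≤ D)
    (hD1 : ∀ j : Fin (d + 1), ∀ s, |s| = r → C * ENNReal.ofReal ((r / 4) ^ (1 / ((d + 2 : ℕ) : ℝ))) *
      W j.succ s ^ (1 / ((d + 2 : ℕ) : ℝ)) ≤ D)
    {v : Euc (d + 2)} (hv : ‖v‖ < 1) (hN : cubeN v = r) :
    ‖G v - G (ins 0 (1 - r) 0)‖ₑ ≤ 2 * D := by
  have hr2 : r ≤ 1 / 2 := by
    push_cast at hrd
    have : (0:ℝ) ≤ d := by positivity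
    nlinarith
  have hcoord0 : ∀ y : Euc (d + 2), 1 - r ≤ y 0 → 1 - b < ‖y‖ := by
    intro y hy
    have h1 := PiLp.norm_apply_le y 0
    rw [Real.norm_eq_abs] at h1
    linarith [le_abs_self (y 0)]
  obtain ⟨c0, cj⟩ := cubeN_coord v
  rw [hN] at c0 cj
  -- bottom face
  have bottom : ∀ w : Euc (d + 2), w 0 = 1 - r → (∀ j : Fin (d + 1), |w j.succ| ≤ r) →
      ‖G w - G (ins 0 (1 - r) 0)‖ₑ ≤ D := by
    intro w hw0 hwj
    refine le_trans ?_ hD0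
    have hins : ins 0 (1 - r) (tl w) = w := by rw [← hw0]; exact ins_tl w
    have hcoord : ∀ x ∈ box (0 : Euc (d + 1)) r, ‖x‖ ^ 2 ≤ ((d + 1 : ℕ) : ℝ) * r ^ 2 := by
      intro x hx
      exact (norm_le_of_coord hr.le (fun i => by simpa using hx i)).1
    have htl : tl w ∈ box (0 : Euc (d + 1)) r := fun j => by simpa using hwj j
    have hmain := face_osc (hW 0) (1 - r) (R := max ‖tl w‖ (r / 4)) hr 0 0 (by simp)
      (fun j => by simp; positivity) (fun x _ hx => by
        have h1 := hcoord x hx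
        have h2 := norm_ins_sq 0 (1 - r) x
        refine ⟨hcoord0 _ (by simp), ?_⟩
        push_cast at h1 hrd
        have : ‖ins 0 (1 - r) x‖ ^ 2 < 1 := by
          rw [h2]
          nlinarith
        nlinarith [norm_nonneg (ins 0 (1 - r) x)])
      (x := tl w) (y := 0) (le_max_left _ _) htl (by simp) (fun j => by simpa using hr.le)
    rwa [hins] at hmain
  by_cases hb : v 0 = 1 - r
  · refine (bottom v hb cj).trans ?_
    calc D = 1 * D := (one_mul _).symm
      _ ≤ 2 * D := by gcongr; norm_num
  · -- side face
    obtain ⟨j, hj⟩ : ∃ j : Fin (d + 1), |v j.succ| = r := by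
      by_contra hc
      push Not at hc
      have hv0 : v 0 < 1 := by
        have h1 := PiLp.norm_apply_le v 0
        rw [Real.norm_eq_abs] at h1
        linarith [le_abs_self (v 0)]
      have : |v 0 - 1| < r := by
        rw [abs_lt]
        rw [abs_le] at c0
        refine ⟨lt_of_le_of_ne c0.1 ?_, by linarith⟩
        intro h; apply hb; linarith
      have := cubeN_lt hr this (fun j => lt_of_le_of_ne (cj j) (hc j))
      linarith
    set e : Euc (d + 1) := EuclideanSpace.single 0 1 with he
    have hen : ‖e‖ = 1 := by simp [he]
    have hbox : rmc j.succ v ∈ box e r := by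
      intro l
      refine Fin.cases ?_ (fun l => ?_) l
      · simpa [he] using c0
      · have := cj (j.succAbove l)
        simpa [he] using this
    have hnv : (v j.succ) ^ 2 + ‖rmc j.succ v‖ ^ 2 < 1 := by
      rw [← norm_ins_sq j.succ, ins_rmc]
      nlinarith [norm_nonneg v]
    have hj2 : (v j.succ) ^ 2 = r ^ 2 := by rw [← hj, sq_abs]
    have hbox2 : (1 - r) • e ∈ box e r := by
      intro l
      have : ((1 - r) • e) l - e l = - r * e l := by
        simp only [PiLp.smul_apply, smul_eq_mul]; ring
      rw [this, abs_mul, abs_neg, abs_of_pos hr]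
      have := PiLp.norm_apply_le e l
      rw [hen, Real.norm_eq_abs] at this
      nlinarith
    have hmain := face_osc (hW j.succ) (v j.succ) (R := max ‖rmc j.succ v‖ (1 - r / 2)) hr e
      ((1 - 3 * r / 4) • e) (by
        rw [norm_smul, hen, mul_one, Real.norm_of_nonneg (by linarith)]
        exact le_trans (by linarith) (le_max_right _ _))
      (fun l => by
        have : ((1 - 3 * r / 4) • e) l - e l = - (3 * r / 4) * e l := by
          simp only [PiLp.smul_apply, smul_eq_mul]; ring
        rw [this, abs_mul, abs_neg, abs_of_pos (by positivity)]
        have := PiLp.norm_apply_le e l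
        rw [hen, Real.norm_eq_abs] at this
        nlinarith) (fun x hx hxb => by
        have h2 := norm_ins_sq j.succ (v j.succ) x
        refine ⟨hcoord0 _ ?_, ?_⟩
        · have h3 := hxb 0
          have h4 : ins j.succ (v j.succ) x 0 = x 0 := by
            have := ins_succAbove j.succ (v j.succ) x 0
            rwa [Fin.succ_succAbove_zero] at this
          rw [h4]
          simp only [he, EuclideanSpace.single_apply, if_true] at h3
          rw [abs_le] at h3
          linarith
        · have : ‖ins j.succ (v j.succ) x‖ ^ 2 < 1 := by
            rw [h2, hj2]
            rcases le_max_iff.1 hx with h | h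
            · nlinarith [norm_nonneg x]
            · nlinarith [norm_nonneg x]
          nlinarith [norm_nonneg (ins j.succ (v j.succ) x)])
      (x := rmc j.succ v) (y := (1 - r) • e) (le_max_left _ _) hbox (by
        rw [norm_smul, hen, mul_one, Real.norm_of_nonneg (by linarith)]
        exact le_trans (by linarith) (le_max_right _ _)) hbox2
    rw [ins_rmc] at hmain
    have h1 := hmain.trans (hD1 j _ hj)
    set w := ins j.succ (v j.succ) ((1 - r) • e) with hw
    have h2 : ‖G w - G (ins 0 (1 - r) 0)‖ₑ ≤ D := by
      apply bottom
      · have := ins_succAbove j.succ (v j.succ) ((1 - r) • e) 0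
        rw [Fin.succ_succAbove_zero] at this
        rw [hw, this]; simp [he]
      · intro l
        rcases Fin.eq_self_or_eq_succAbove j l with rfl | ⟨k, rfl⟩
        · rw [hw, ins_same, hj]
        · have := ins_succAbove j.succ (v j.succ) ((1 - r) • e) k.succ
          rw [Fin.succ_succAbove_succ] at this
          rw [hw, this]; simp [he, hr.le]
    have : G v - G (ins 0 (1 - r) 0) = (G v - G w) + (G w - G (ins 0 (1 - r) 0)) := by abel
    rw [this]
    calc _ ≤ D + D := (enorm_add_le _ _).trans (add_le_add h1 h2)
      _ = 2 * D := by ring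

theorem shell_small {k : ℕ} {w : Euc k → ℝ≥0∞} (hw : ∫⁻ y in unitBall k, w y ≠ ⊤) {ε : ℝ≥0∞}
    (hε : 0 < ε) : ∃ b0 > 0, ∫⁻ y in {y : Euc k | 1 - b0 < ‖y‖ ∧ ‖y‖ < 1}, w y < ε := by
  set μ : Measure (Euc k) := volume.restrict (unitBall k) with hμ
  set s : ℕ → Set (Euc k) := fun i => {y | 1 - 1 / ((i : ℝ) + 1) < ‖y‖} with hs
  have hsm : ∀ i, MeasurableSet (s i) := fun i =>
    (isOpen_lt continuous_const continuous_norm).measurableSet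
  have hvol : volume (unitBall k) ≠ ⊤ := measure_ball_lt_top.ne
  have hμs : Filter.Tendsto (μ ∘ s) Filter.atTop (nhds (μ (⋂ i, s i))) := by
    apply tendsto_measure_iInter_atTop (fun i => (hsm i).nullMeasurableSet)
    · intro i j hij y hy
      simp only [hs, mem_ofPred_eq] at hy ⊢
      have : 1 / ((j : ℝ) + 1) ≤ 1 / ((i : ℝ) + 1) := by
        have : (i : ℝ) ≤ j := by exact_mod_cast hij
        gcongr
      linarith
    · refine ⟨0, ?_⟩
      rw [hμ]
      rw [Measure.restrict_apply (hsm 0)]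
      exact ((measure_mono inter_subset_right).trans_lt hvol.lt_top).ne
  have hz : μ (⋂ i, s i) = 0 := by
    rw [hμ, Measure.restrict_apply (MeasurableSet.iInter hsm)]
    convert measure_empty (μ := (volume : Measure (Euc k)))
    ext y
    simp only [mem_inter_iff, mem_iInter, mem_empty_iff_false, iff_false, not_and, hs, mem_ofPred_eq]
    intro h hy
    have hy1 : ‖y‖ < 1 := by simpa [unitBall] using hy
    obtain ⟨i, hi⟩ := exists_nat_one_div_lt (sub_pos.2 hy1)
    have := h i
    linarith
  rw [hz] at hμs
  have hlim := tendsto_setLIntegral_zero (μ := μ) (f := w) hw hμs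
  obtain ⟨i, hi⟩ := (hlim.eventually_lt_const hε).exists
  refine ⟨1 / ((i : ℝ) + 1), by positivity, ?_⟩
  refine lt_of_le_of_lt (le_of_eq ?_) hi
  rw [hμ, Measure.restrict_restrict (hsm i)]
  congr 2
  ext y
  simp [hs, unitBall]

theorem pick_log {W : ℝ → ℝ≥0∞} {M : ℝ} (hM : 0 < M) (hW : ∫⁻ s, W s < ENNReal.ofReal M)
    {a b : ℝ} (ha : 0 < a) (hab : a < b) :
    ∃ r ∈ Ioo a b, ENNReal.ofReal r * W r ≤ ENNReal.ofReal (M / Real.log (b / a)) := by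
  by_contra hc
  push Not at hc
  have hl : 0 < Real.log (b / a) := Real.log_pos (by rw [lt_div_iff₀ ha]; linarith)
  have h1 : ∀ s ∈ Ioo a b, ENNReal.ofReal (M / Real.log (b / a) * s⁻¹) ≤ W s := by
    intro s hs
    have hs0 : 0 < s := ha.trans hs.1
    have h2 := hc s hs
    rw [ENNReal.ofReal_mul (by positivity), ENNReal.ofReal_inv_of_pos hs0]
    rw [← div_eq_mul_inv]
    apply ENNReal.div_le_of_le_mul
    rw [mul_comm]
    exact h2.le
  have h2 : ∫⁻ s in Ioo a b, ENNReal.ofReal (M / Real.log (b / a) * s⁻¹) = ENNReal.ofReal M := by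
    have hIntg : IntervalIntegrable (fun s : ℝ => M / Real.log (b / a) * s⁻¹) volume a b := by
      apply ContinuousOn.intervalIntegrable
      rw [uIcc_of_le hab.le]
      refine continuousOn_const.mul (continuousOn_inv₀.mono ?_)
      intro x hx
      exact (ha.trans_le hx.1).ne'
    have hi := (intervalIntegrable_iff_integrableOn_Ioo_of_le hab.le).1 hIntg
    rw [← ofReal_integral_eq_lintegral_ofReal hi, ← integral_Ioc_eq_integral_Ioo,
      ← intervalIntegral.integral_of_le hab.le, intervalIntegral.integral_const_mul,
      integral_inv_of_pos ha (ha.trans hab), div_mul_cancel₀ _ hl.ne']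
    filter_upwards [ae_restrict_mem measurableSet_Ioo] with s hs
    have hs0 : 0 < s := ha.trans hs.1
    simp only [Pi.zero_apply]
    positivity
  have h3 := (setLIntegral_mono' (μ := volume) measurableSet_Ioo h1).trans
    (setLIntegral_le_lintegral _ W)
  rw [h2] at h3
  exact absurd hW (not_lt.2 h3)

theorem osc_h {d : ℕ} {h : Euc (d + 2) → Euc (d + 2)}
    {Dh : Euc (d + 2) → Matrix (Fin (d + 2)) (Fin (d + 2)) ℝ}
    (hc : ContinuousOn h (unitBall (d + 2)))
    (hS : MemSobolev ((d + 2 : ℕ) : ℝ) (unitBall (d + 2)) h Dh) {η : ℝ} (hη : 0 < η) :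
    ∃ b0 > 0, b0 * ((d + 2 : ℕ) : ℝ) ≤ 1 ∧ ∀ (L : Euc (d + 2) ≃ₗᵢ[ℝ] Euc (d + 2)) (a b : ℝ), 0 < a → a < b →
      b ≤ b0 → ∃ r ∈ Ioo a b, ∀ v v' : Euc (d + 2), ‖v‖ < 1 → ‖v'‖ < 1 → cubeN v = r →
      cubeN v' = r → ‖h (L v) - h (L v')‖ ^ (d + 2) ≤ η / Real.log (b / a) := by
  have hp1 : (1:ℝ) < ((d + 2 : ℕ) : ℝ) := by push_cast; linarith [show (0:ℝ) ≤ d by positivity]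
  have hp : ((d + 1 : ℕ) : ℝ) < ((d + 2 : ℕ) : ℝ) := by push_cast; linarith
  obtain ⟨C, hC, hO⟩ := slice_osc (d + 1) hp1 hp (8 * ((d + 1 : ℕ) : ℝ))
  set M : ℝ := η / (4 ^ (d + 2) * C.toReal ^ (d + 2) + 1) with hM
  have hM0 : 0 < M := by positivity
  have hfin : ∫⁻ y in unitBall (d + 2), ENNReal.ofReal (opNorm (Dh y) ^ ((d + 2 : ℕ) : ℝ)) ≠ ⊤ :=
    hS.lp.lintegral_lt_top.ne
  obtain ⟨b1, hb1, hE⟩ := shell_small hfin (ε := ENNReal.ofReal (M / (2 * d + 3)))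
    (by rw [ENNReal.ofReal_pos]; positivity)
  refine ⟨min b1 (1 / ((d + 2 : ℕ) : ℝ)), by positivity, ?_, ?_⟩
  · have := min_le_right b1 (1 / ((d + 2 : ℕ) : ℝ))
    rwa [le_div_iff₀ (by positivity)] at this
  intro L a b ha hab hb
  have hbb1 : b ≤ b1 := hb.trans (min_le_left _ _)
  have hbd : b * ((d + 2 : ℕ) : ℝ) ≤ 1 := by
    have := hb.trans (min_le_right b1 (1 / ((d + 2 : ℕ) : ℝ)))
    rwa [le_div_iff₀ (by positivity)] at this
  set U : Set (Euc (d + 2)) := {y | 1 - b1 < ‖y‖ ∧ ‖y‖ < 1} with hU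
  have hUo : IsOpen U := (isOpen_lt continuous_const continuous_norm).inter
    (isOpen_lt continuous_norm continuous_const)
  have hUs : U ⊆ unitBall (d + 2) := by
    intro y hy
    simpa [unitBall] using hy.2
  choose W hWm hWi hWo using fun i => hO _ U h Dh isOpen_ball hUo hUs hc hS L i
  have hexp : (1 - ((d + 1 : ℕ) : ℝ) / ((d + 2 : ℕ) : ℝ)) = 1 / ((d + 2 : ℕ) : ℝ) := by
    push_cast; field_simp; ring
  have hSP : ∀ i, SliceProp d C U (fun v => h (L v)) i (W i) := by
    intro i s Q hQ hQc hQU c ρ hρ hcQ hdi x hx y hy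
    have := hWo i s Q hQ hQc (fun x hx => by
      have := hQU x hx
      simpa [hU] using this) c ρ hρ hcQ hdi x hx y hy
    rwa [hexp] at this
  set Wt : ℝ → ℝ≥0∞ := fun r => W 0 (1 - r) + ∑ j : Fin (d + 1), (W j.succ r + W j.succ (-r)) with hWt
  have hWtint : ∫⁻ r, Wt r < ENNReal.ofReal M := by
    set E := ∫⁻ y in U, ENNReal.ofReal (opNorm (Dh y) ^ ((d + 2 : ℕ) : ℝ)) with hEdef
    have e1 : ∫⁻ r, Wt r ≤ (2 * d + 3 : ℕ) * E := by
      have hm0 : Measurable (fun r : ℝ => W 0 (1 - r)) := (hWm 0).comp (by fun_prop)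
      simp only [hWt]
      rw [lintegral_add_left hm0,
        lintegral_finsetSum _ (fun j _ => ((hWm j.succ).add ((hWm j.succ).comp measurable_neg)))]
      have e2 : ∀ j : Fin (d + 1), ∫⁻ r, (W j.succ r + W j.succ (-r)) ≤ 2 * E := by
        intro j
        rw [lintegral_add_left (hWm j.succ), lintegral_neg_eq_self (W j.succ), two_mul]
        exact add_le_add (hWi _) (hWi _)
      rw [lintegral_sub_left_eq_self (W 0) 1]
      calc _ ≤ E + ∑ j : Fin (d + 1), 2 * E := add_le_add (hWi 0) (Finset.sum_le_sum fun j _ => e2 j)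
        _ = _ := by
          simp only [Finset.sum_const, Finset.card_univ, Fintype.card_fin, nsmul_eq_mul]
          push_cast; ring
    refine e1.trans_lt ?_
    have e3 : ENNReal.ofReal M = (2 * d + 3 : ℕ) * ENNReal.ofReal (M / (2 * d + 3)) := by
      rw [← ENNReal.ofReal_natCast, ← ENNReal.ofReal_mul (by positivity)]
      congr 1; push_cast; field_simp
    rw [e3]
    exact (ENNReal.mul_lt_mul_iff_right (Nat.cast_ne_zero.2 (by omega)) (ENNReal.natCast_ne_top _)).2 hE
  obtain ⟨r, hr, hrW⟩ := pick_log hM0 hWtint ha hab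
  refine ⟨r, hr, fun v v' hv hv' hN hN' => ?_⟩
  have hr0 : 0 < r := ha.trans hr.1
  have hl : 0 < Real.log (b / a) := Real.log_pos (by rw [lt_div_iff₀ ha]; linarith)
  set q : ℝ := 1 / ((d + 2 : ℕ) : ℝ) with hq
  have hq0 : 0 < q := by positivity
  set D : ℝ≥0∞ := C * ENNReal.ofReal ((r / 4) ^ q) * Wt r ^ q with hD
  have hrd : r * (d + 2 : ℕ) ≤ 1 := le_trans (by have := hr.2; gcongr) hbd
  have key : ∀ v : Euc (d + 2), ‖v‖ < 1 → cubeN v = r →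
      ‖h (L v) - h (L (ins 0 (1 - r) 0))‖ₑ ≤ 2 * D := by
    intro v hv hN
    refine cube_osc hSP hr0 (hr.2.trans_le hbb1) hrd ?_ ?_ hv hN
    · rw [hD]
      refine mul_le_mul_right (ENNReal.rpow_le_rpow ?_ hq0.le) _
      rw [hWt]; exact le_self_add
    · intro j s hs
      rw [hD]
      refine mul_le_mul_right (ENNReal.rpow_le_rpow ?_ hq0.le) _
      have h1 : W j.succ s ≤ W j.succ r + W j.succ (-r) := by
        rcases eq_or_eq_neg_of_abs_eq hs with rfl | rfl
        · exact le_self_add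
        · exact le_add_self
      refine h1.trans (le_trans ?_ (le_add_self))
      exact Finset.single_le_sum (f := fun j : Fin (d + 1) => W j.succ r + W j.succ (-r))
        (fun _ _ => zero_le) (Finset.mem_univ j)
  have h4 : ‖h (L v) - h (L v')‖ₑ ≤ 4 * D := by
    have : h (L v) - h (L v') = (h (L v) - h (L (ins 0 (1 - r) 0))) -
      (h (L v') - h (L (ins 0 (1 - r) 0))) := by abel
    rw [this]
    calc _ ≤ 2 * D + 2 * D := (enorm_sub_le).trans (add_le_add (key v hv hN) (key v' hv' hN'))
      _ = 4 * D := by ring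
  have hqn : q * ((d + 2 : ℕ) : ℝ) = 1 := by rw [hq]; field_simp
  have h5 : D ^ (d + 2) = C ^ (d + 2) * ENNReal.ofReal (r / 4) * Wt r := by
    rw [hD, mul_pow, mul_pow, ← ENNReal.rpow_natCast (Wt r ^ q), ← ENNReal.rpow_mul, hqn,
      ENNReal.rpow_one, ← ENNReal.ofReal_pow (by positivity), ← Real.rpow_natCast, ← Real.rpow_mul
      (by positivity), hqn, Real.rpow_one]
  have h6 : ‖h (L v) - h (L v')‖ₑ ^ (d + 2) ≤
      ENNReal.ofReal (4 ^ (d + 2) * C.toReal ^ (d + 2) * (M / Real.log (b / a))) := by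
    calc _ ≤ (4 * D) ^ (d + 2) := by gcongr
      _ = 4 ^ (d + 2) * (C ^ (d + 2) * (ENNReal.ofReal (r / 4) * Wt r)) := by
        rw [mul_pow, h5]; ring
      _ ≤ 4 ^ (d + 2) * (C ^ (d + 2) * (ENNReal.ofReal r * Wt r)) := by
        gcongr; linarith
      _ ≤ 4 ^ (d + 2) * (C ^ (d + 2) * ENNReal.ofReal (M / Real.log (b / a))) := by gcongr
      _ = _ := by
        rw [ENNReal.ofReal_mul (by positivity), ENNReal.ofReal_mul (by positivity),
          ENNReal.ofReal_pow (by positivity), ENNReal.ofReal_pow (by positivity),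
          ENNReal.ofReal_toReal hC.ne]
        simp [mul_assoc]
  rw [← ofReal_norm, ← ENNReal.ofReal_pow (norm_nonneg _),
    ENNReal.ofReal_le_ofReal_iff (by positivity)] at h6
  refine h6.trans ?_
  rw [← mul_div_assoc]
  gcongr
  rw [hM, mul_div_assoc', div_le_iff₀ (by positivity)]
  nlinarith

theorem cap_compl_preconnected {k : ℕ} {r R : ℝ} (hr : 0 < r) (hr1 : r < 1) (hR : 0 < R)
    (hR1 : R ≤ 1) (hRr : (1 - r) ^ 2 + k * r ^ 2 ≤ R ^ 2) :
    IsPreconnected {v : Euc (k + 1) | ‖v‖ = R ∧ r < cubeN v} := by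
  set S : Set (Euc (k + 1)) := {v | v ≠ 0 ∧ (v 0 ≤ 0 ∨ ∃ j : Fin k, r * ‖v‖ < R * |v j.succ|)} with hS
  set e : Euc (k + 1) := EuclideanSpace.single 0 1 with he
  have he0 : e 0 = 1 := by simp [he]
  have hej : ∀ j : Fin k, e j.succ = 0 := by intro j; simp [he]
  have hne : ∀ v : Euc (k + 1), ∀ i, v i ≠ 0 → v ≠ 0 := by
    intro v i hi h
    apply hi; rw [h]; rfl
  have heS : -e ∈ S := ⟨hne _ 0 (by simp [he0]), Or.inl (by simp [he0])⟩
  have hstar : StarConvex ℝ (-e) S := by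
    rw [starConvex_iff_forall_pos heS]
    rintro v ⟨hv0, hv⟩ a b ha hb hab
    set w := a • (-e) + b • v with hw
    have hw0 : w 0 = -a + b * v 0 := by simp [hw, he0]
    have hwj : ∀ j : Fin k, w j.succ = b * v j.succ := by intro j; simp [hw, hej]
    by_cases hneg : v 0 ≤ 0
    · have : w 0 < 0 := by rw [hw0]; nlinarith
      exact ⟨hne _ 0 this.ne, Or.inl this.le⟩
    · rcases hv with h | ⟨j, hj⟩
      · exact absurd h hneg
      · push Not at hneg
        have hvn : 0 < ‖v‖ := norm_pos_iff.2 hv0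
        have hvj : 0 < |v j.succ| := by
          have : 0 < r * ‖v‖ := by positivity
          by_contra hc
          have hc' : |v j.succ| ≤ 0 := not_lt.1 hc
          nlinarith
        refine ⟨hne _ j.succ (by rw [hwj]; exact mul_ne_zero hb.ne' (abs_pos.1 hvj)), ?_⟩
        by_cases hw' : w 0 ≤ 0
        · exact Or.inl hw'
        · right
          push Not at hw'
          refine ⟨j, ?_⟩
          rw [hwj, abs_mul, abs_of_pos hb]
          have htl : tl w = b • tl v := by
            ext l
            rw [tl_apply, hwj]; simp
          have hn : ‖w‖ ≤ b * ‖v‖ := by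
            apply abs_le_of_sq_le_sq' _ (by positivity) |>.2
            rw [mul_pow, norm_sq_tl w, norm_sq_tl v, htl, norm_smul, Real.norm_of_nonneg hb.le]
            have : w 0 ^ 2 ≤ (b * v 0) ^ 2 := by
              have : w 0 ≤ b * v 0 := by rw [hw0]; linarith
              gcongr
            nlinarith
          calc r * ‖w‖ ≤ r * (b * ‖v‖) := by gcongr
            _ = b * (r * ‖v‖) := by ring
            _ < b * (R * |v j.succ|) := by gcongr
            _ = _ := by ring
  have hSp : IsPreconnected S := (hstar.isPathConnected heS).isConnected.isPreconnected
  have himg : {v : Euc (k + 1) | ‖v‖ = R ∧ r < cubeN v} = (fun v => (R / ‖v‖) • v) '' S := by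
    ext v
    simp only [mem_image, mem_ofPred_eq]
    constructor
    · rintro ⟨hv, hN⟩
      refine ⟨v, ⟨?_, ?_⟩, by rw [hv, div_self hR.ne', one_smul]⟩
      · rw [← norm_pos_iff, hv]; exact hR
      · by_contra hc
        push Not at hc
        obtain ⟨h0, hj⟩ := hc
        have hj' : ∀ j : Fin k, |v j.succ| ≤ r := by
          intro j
          have := hj j
          rw [hv] at this
          nlinarith
        have h1 : ‖tl v‖ ^ 2 ≤ k * r ^ 2 := (norm_le_of_coord hr.le (fun i => hj' i)).1
        have h2 := norm_sq_tl v
        rw [hv] at h2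
        have h3 : 1 - r ≤ v 0 := by nlinarith
        have h4 : v 0 ≤ 1 := by
          have h1 := PiLp.norm_apply_le v 0
          rw [Real.norm_eq_abs, hv] at h1
          linarith [le_abs_self (v 0)]
        have : cubeN v ≤ r := by
          rw [cubeN, pi_norm_le_iff_of_nonneg hr.le]
          intro i
          refine Fin.cases ?_ (fun j => ?_) i
          · simp only [PiLp.sub_apply, PiLp.single_apply, if_true, Real.norm_eq_abs, abs_le]
            constructor <;> simp <;> linarith
          · simpa using hj' j
        linarith
    · rintro ⟨w, ⟨hw0, hw⟩, rfl⟩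
      have hwn : 0 < ‖w‖ := norm_pos_iff.2 hw0
      have hc : 0 < R / ‖w‖ := by positivity
      refine ⟨?_, ?_⟩
      · rw [norm_smul, Real.norm_of_nonneg hc.le, div_mul_cancel₀ _ hwn.ne']
      · obtain ⟨c0, cj⟩ := cubeN_coord ((R / ‖w‖) • w)
        rcases hw with h | ⟨j, hj⟩
        · refine lt_of_lt_of_le ?_ c0
          rw [lt_abs]; right
          simp only [PiLp.smul_apply, smul_eq_mul]
          have : R / ‖w‖ * w 0 ≤ 0 := mul_nonpos_of_nonneg_of_nonpos hc.le h
          linarith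
        · refine lt_of_lt_of_le ?_ (cj j)
          simp only [PiLp.smul_apply, smul_eq_mul]
          rw [abs_mul, abs_of_pos hc, div_mul_eq_mul_div, lt_div_iff₀ hwn]
          exact hj
  rw [himg]
  refine hSp.image _ ?_
  have hn0 : ∀ x ∈ S, ‖x‖ ≠ 0 := fun x hx => norm_ne_zero_iff.2 hx.1
  exact (continuousOn_const.div continuous_norm.continuousOn hn0).smul continuousOn_id

theorem escape {k : ℕ} {H F : Euc k → Euc k} {Ω : Set (Euc k)} (hH : IsHomeoOn H F (unitBall k) Ω)
    {Γ : Set (Euc k)} (hΓ : Γ ⊆ Ω) {z : Euc k} (hz : z ∈ closure Γ) (hz' : z ∉ Ω) {R : ℝ} (hR : R < 1) :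
    ∃ y ∈ Γ, R < ‖F y‖ := by
  by_contra hc
  push Not at hc
  have hsub : closedBall (0 : Euc k) R ⊆ unitBall k := closedBall_subset_ball hR
  have hcomp : IsCompact (H '' closedBall 0 R) :=
    (isCompact_closedBall _ _).image_of_continuousOn (hH.continuousOn.mono hsub)
  have h1 : Γ ⊆ H '' closedBall 0 R := by
    intro y hy
    exact ⟨F y, by simpa using hc y hy, hH.right_inv y (hΓ hy)⟩
  obtain ⟨x, hx, rfl⟩ := closure_minimal h1 hcomp.isClosed hz
  exact hz' (hH.mapsTo (hsub hx))

theorem inner_bound {k : ℕ} {H F : Euc k → Euc k} {Ω : Set (Euc k)}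
    (hH : IsHomeoOn H F (unitBall k) Ω) {K : Set (Euc k)} (hK : IsCompact K) (hKΩ : K ⊆ Ω) :
    ∃ R < 1, ∀ y ∈ K, ‖F y‖ ≤ R := by
  rcases K.eq_empty_or_nonempty with rfl | hne
  · exact ⟨0, by norm_num, by simp⟩
  · obtain ⟨y, hy, hmax⟩ := hK.exists_isMaxOn hne ((hH.continuousOn_inv.mono hKΩ).norm)
    refine ⟨‖F y‖, ?_, fun z hz => hmax hz⟩
    simpa [unitBall] using hH.mapsTo_inv (hKΩ hy)

theorem pair_avoid {k : ℕ} {H F : Euc (k + 1) → Euc (k + 1)} {Ω : Set (Euc (k + 1))}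
    (hH : IsHomeoOn H F (unitBall (k + 1)) Ω) {r δ : ℝ}
    (hosc : ∀ v v' : Euc (k + 1), ‖v‖ < 1 → ‖v'‖ < 1 → cubeN v = r → cubeN v' = r →
      ‖H v - H v'‖ < δ) {Γ Γ' : Set (Euc (k + 1))} (hΓ : Γ ⊆ Ω) (hΓ' : Γ' ⊆ Ω)
    (hp : IsPreconnected Γ) (hp' : IsPreconnected Γ') {a a' : Euc (k + 1)} (ha : a ∈ Γ) (ha' : a' ∈ Γ')
    (hFa : ‖F a‖ < 1 - r) (hFa' : ‖F a'‖ < 1 - r) (hd : ∀ y ∈ Γ, ∀ y' ∈ Γ', δ ≤ ‖y - y'‖) :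
    (∀ y ∈ Γ, r < cubeN (F y)) ∨ (∀ y ∈ Γ', r < cubeN (F y)) := by
  by_contra hc
  push Not at hc
  obtain ⟨⟨y, hy, hyr⟩, ⟨y', hy', hyr'⟩⟩ := hc
  have hbase : ∀ v : Euc (k + 1), ‖v‖ < 1 - r → r ≤ cubeN v := by
    intro v hv
    have h1 := (cubeN_coord v).1
    have h2 := PiLp.norm_apply_le v 0
    rw [Real.norm_eq_abs] at h2
    have h3 := neg_abs_le (v 0 - 1)
    have h4 := le_abs_self (v 0)
    linarith
  have hcross : ∀ Γ : Set (Euc (k + 1)), Γ ⊆ Ω → IsPreconnected Γ → ∀ a ∈ Γ, ‖F a‖ < 1 - r →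
      ∀ y ∈ Γ, cubeN (F y) ≤ r → ∃ z ∈ Γ, cubeN (F z) = r := by
    intro Γ hΓ hp a ha hFa y hy hyr
    have hcont : ContinuousOn (fun z => cubeN (F z)) Γ :=
      continuous_cubeN.comp_continuousOn (hH.continuousOn_inv.mono hΓ)
    exact hp.intermediate_value hy ha hcont ⟨hyr, hbase _ hFa⟩
  obtain ⟨z, hz, hzr⟩ := hcross Γ hΓ hp a ha hFa y hy hyr
  obtain ⟨z', hz', hzr'⟩ := hcross Γ' hΓ' hp' a' ha' hFa' y' hy' hyr'
  have hb : ∀ z ∈ Ω, ‖F z‖ < 1 := fun z hz => by simpa [unitBall] using hH.mapsTo_inv hz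
  have := hosc (F z) (F z') (hb z (hΓ hz)) (hb z' (hΓ' hz')) hzr hzr'
  rw [hH.right_inv z (hΓ hz), hH.right_inv z' (hΓ' hz')] at this
  linarith [hd z hz z' hz']

theorem continuous_coord0 {k : ℕ} : Continuous (fun y : Euc (k + 1) => (y 0 : ℝ)) := continuous_coord 0

theorem isClosed_coord0 {k : ℕ} (t : ℝ) : IsClosed {y : Euc (k + 1) | y 0 = t} :=
  (isClosed_singleton (x := t)).preimage continuous_coord0

theorem continuous_qfun {k : ℕ} (t : ℝ) :
    Continuous (fun y : Euc (k + 1) => max ((y 0 : ℝ) - t) (‖y‖ - 1 / 2)) := by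
  have h : Continuous (fun q : ℝ × ℝ => max (q.1 - t) (q.2 - 1 / 2)) := by fun_prop
  exact h.comp (continuous_coord0.prodMk continuous_norm)

set_option maxHeartbeats 800000 in
theorem core_contra {k : ℕ} {α : ℝ} (hα : 3 ≤ α) {H F : Euc (k + 1) → Euc (k + 1)}
    (hH : IsHomeoOn H F (unitBall (k + 1)) (cuspBall (k + 1) (cuspFun α))) {t r : ℝ}
    (ht : 0 < t) (ht8 : t < 1 / 8) (hr : 0 < r) (hrk : (k + 1) * r < 2) (hr1 : r < 1)
    (hdisc : ∀ x : Euc k, cuspFun α t < ‖x‖ → ‖x‖ ≤ 3 * cuspFun α t →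
      ‖F (ins 0 t x) - EuclideanSpace.single 0 1‖ < r)
    {Γ Γ' : Set (Euc (k + 1))} (hΓ : Γ ⊆ cuspBall (k + 1) (cuspFun α))
    (hΓ' : Γ' ⊆ cuspBall (k + 1) (cuspFun α))
    (hp : IsPreconnected Γ) (hp' : IsPreconnected Γ') {a a' : Euc (k + 1)} (ha : a ∈ Γ) (ha' : a' ∈ Γ')
    (hFa : ‖F a‖ < 1 - r) (hFa' : ‖F a'‖ < 1 - r) {z z' : Euc (k + 1)} (hz : z ∈ closure Γ)
    (hzn : z ∉ cuspBall (k + 1) (cuspFun α)) (hz' : z' ∈ closure Γ')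
    (hzn' : z' ∉ cuspBall (k + 1) (cuspFun α))
    (hN : ∀ y ∈ Γ, r < cubeN (F y)) (hN' : ∀ y ∈ Γ', r < cubeN (F y))
    (hin : ∀ y ∈ Γ, y 0 < t ∧ ‖y‖ < 1 / 2) (hout : ∀ y ∈ Γ', 1 / 2 < ‖y‖) : False := by
  set Ω := cuspBall (k + 1) (cuspFun α) with hΩ
  set u := cuspFun α t with hu
  have hu0 : 0 < u := cuspFun_pos ht
  have hut : u ≤ 1 / 64 := by
    have h1 := cuspFun_le hα ht (by linarith)
    have : t ^ 3 ≤ (1 / 8) ^ 3 := by gcongr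
    norm_num at this ⊢; linarith
  set Z : Set (Euc (k + 1)) := closedBall 0 (1 / 2) ∩ ({y | y 0 ≤ t} ∩
    ({y | ‖y‖ = 1 / 2} ∪ ({y | y 0 = t} ∩ {y | 3 * u ≤ ‖tl y‖}))) with hZ
  have hZc : IsCompact Z := by
    refine (isCompact_closedBall _ _).inter_right ?_
    exact (isClosed_le (continuous_coord 0) continuous_const).inter
      ((isClosed_eq continuous_norm continuous_const).union
        ((isClosed_coord0 t).inter
          (isClosed_le continuous_const (continuous_norm.comp continuous_tl))))
  have hZΩ : Z ⊆ Ω := by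
    rintro y ⟨hy1, hy2, hy3⟩
    rw [mem_closedBall_zero_iff] at hy1
    rw [hΩ, mem_cusp]
    refine ⟨by linarith, ?_⟩
    simp only [mem_ofPred_eq] at hy2
    rcases hy3 with h | ⟨h1, h2⟩
    · simp only [mem_ofPred_eq] at h
      by_cases hneg : y 0 < 0
      · exact Or.inl hneg
      · right
        push Not at hneg
        have h1 : cuspFun α (y 0) ≤ u := cuspFun_mono (by linarith) hy2
        have h2 := norm_sq_tl y
        rw [h] at h2
        nlinarith [norm_nonneg (tl y)]
    · right
      simp only [mem_ofPred_eq] at h1 h2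
      rw [h1]
      linarith
  obtain ⟨R1, hR1, hFZ⟩ := inner_bound hH hZc hZΩ
  set A : ℝ := (1 - r) ^ 2 + k * r ^ 2 with hA
  have hA1 : A < 1 := by rw [hA]; nlinarith
  set ρ := max R1 (max (1 - r) A) with hρ
  have hρ1 : ρ < 1 := by
    rw [hρ]; exact max_lt hR1 (max_lt (by linarith) hA1)
  have hρR : R1 ≤ ρ := le_max_left _ _
  have hρr : 1 - r ≤ ρ := (le_max_left _ _).trans (le_max_right _ _)
  have hρA : A ≤ ρ := (le_max_right _ _).trans (le_max_right _ _)
  set R := (1 + ρ) / 2 with hR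
  have hRρ : ρ < R := by rw [hR]; linarith
  have hR1' : R < 1 := by rw [hR]; linarith
  have hRA : A ≤ R ^ 2 := by rw [hR]; nlinarith [sq_nonneg (1 - ρ)]
  have hRpos : 0 < R := by linarith
  have level : ∀ Γ : Set (Euc (k + 1)), Γ ⊆ Ω → IsPreconnected Γ → ∀ a ∈ Γ, ‖F a‖ < 1 - r →
      ∀ z ∈ closure Γ, z ∉ Ω → ∃ y ∈ Γ, ‖F y‖ = R := by
    intro Γ hΓ hp a ha hFa z hz hzn
    obtain ⟨y, hy, hyR⟩ := escape hH hΓ hz hzn hR1'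
    exact hp.intermediate_value ha hy ((hH.continuousOn_inv.mono hΓ).norm) ⟨by linarith, hyR.le⟩
  obtain ⟨y, hy, hyR⟩ := level Γ hΓ hp a ha hFa z hz hzn
  obtain ⟨y', hy', hyR'⟩ := level Γ' hΓ' hp' a' ha' hFa' z' hz' hzn'
  have hT := cap_compl_preconnected (k := k) hr hr1 hRpos hR1'.le hRA
  have hTB : {v : Euc (k + 1) | ‖v‖ = R ∧ r < cubeN v} ⊆ unitBall (k + 1) := by
    rintro v ⟨hv, -⟩
    simp [unitBall, hv, hR1']
  have hq : Continuous (fun y : Euc (k + 1) => max (y 0 - t) (‖y‖ - 1 / 2)) :=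
    continuous_qfun t
  have hqH := hq.comp_continuousOn (hH.continuousOn.mono hTB)
  obtain ⟨v, ⟨hvR, hvN⟩, hv0⟩ := hT.intermediate_value (a := F y) (b := F y')
    ⟨hyR, hN y hy⟩ ⟨hyR', hN' y' hy'⟩ hqH (show (0:ℝ) ∈ _ by
      simp only [Function.comp_def, hH.right_inv y (hΓ hy), hH.right_inv y' (hΓ' hy'), mem_Icc]
      constructor
      · exact max_le (by linarith [(hin y hy).1]) (by linarith [(hin y hy).2])
      · exact le_max_of_le_right (by linarith [hout y' hy']))
  simp only [Function.comp_def] at hv0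
  have hvB : v ∈ unitBall (k + 1) := hTB ⟨hvR, hvN⟩
  have hFH := hH.left_inv v hvB
  have hHΩ := hH.mapsTo hvB
  set w := H v with hw
  have hw1 : w 0 ≤ t := by linarith [le_max_left (w 0 - t) (‖w‖ - 1 / 2)]
  have hw2 : ‖w‖ ≤ 1 / 2 := by linarith [le_max_right (w 0 - t) (‖w‖ - 1 / 2)]
  have hwZ : w ∉ Z := by
    intro hwZ
    have := hFZ w hwZ
    rw [hFH, hvR] at this
    linarith
  have hcase : w 0 = t ∧ ‖tl w‖ < 3 * u := by
    rcases max_choice (w 0 - t) (‖w‖ - 1 / 2) with h | h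
    · rw [h] at hv0
      have hwt : w 0 = t := by linarith
      refine ⟨hwt, ?_⟩
      by_contra hc
      push Not at hc
      exact hwZ ⟨by simpa using hw2, hw1, Or.inr ⟨hwt, hc⟩⟩
    · rw [h] at hv0
      exact absurd ⟨by simpa using hw2, hw1, Or.inl (by simp only [mem_ofPred_eq]; linarith)⟩ hwZ
  obtain ⟨hwt, hwu⟩ := hcase
  have hwu' : u < ‖tl w‖ := by
    have h1 := ((mem_cusp w).1 hHΩ).2
    rw [hwt] at h1
    rcases h1 with h | h
    · linarith
    · exact h
  have hfin := hdisc (tl w) hwu' hwu.le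
  have hwins : ins 0 t (tl w) = w := by rw [← hwt]; exact ins_tl w
  rw [hwins, hFH] at hfin
  linarith [cubeN_le v]

theorem topo_contra {k : ℕ} {α : ℝ} (hα : 3 ≤ α) {H F : Euc (k + 1) → Euc (k + 1)}
    (hH : IsHomeoOn H F (unitBall (k + 1)) (cuspBall (k + 1) (cuspFun α))) {t r : ℝ}
    (ht : 0 < t) (ht8 : t < 1 / 8) (hr : 0 < r) (hrk : (k + 1) * r < 2) (hr1 : r < 1)
    {e₁ : Euc k} (he : ‖e₁‖ = 1)
    (hK1 : ‖F (ins 0 (-(1 / 4)) 0)‖ < 1 - r) (hK3 : ‖F (ins 0 (-(3 / 4)) 0)‖ < 1 - r)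
    (hK4 : ‖F (ins 0 0 ((3 / 4 : ℝ) • e₁))‖ < 1 - r)
    (hK2 : ‖F (ins 0 (t / 2) ((1 / 4 : ℝ) • e₁))‖ < 1 - r)
    (hosc : ∀ v v' : Euc (k + 1), ‖v‖ < 1 → ‖v'‖ < 1 → cubeN v = r → cubeN v' = r →
      ‖H v - H v'‖ < t / 2)
    (hdisc : ∀ x : Euc k, cuspFun α t < ‖x‖ → ‖x‖ ≤ 3 * cuspFun α t →
      ‖F (ins 0 t x) - EuclideanSpace.single 0 1‖ < r) : False := by
  set Ω := cuspBall (k + 1) (cuspFun α) with hΩ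
  have hnorm : ∀ (a s : ℝ), ‖ins 0 a (s • e₁)‖ ^ 2 = a ^ 2 + s ^ 2 := by
    intro a s
    rw [norm_ins_sq, norm_smul, he, mul_one, Real.norm_eq_abs, sq_abs]
  have hmem : ∀ (a s : ℝ), ins 0 a (s • e₁) ∈ Ω ↔ a ^ 2 + s ^ 2 < 1 ∧ (a < 0 ∨ cuspFun α a < |s|) := by
    intro a s
    rw [hΩ, mem_cusp, ← hnorm, tl_ins, ins_same, norm_smul, he, mul_one, Real.norm_eq_abs,
      sq_lt_one_iff₀ (norm_nonneg _)]
  have hcoord : ∀ y y' : Euc (k + 1), y' 0 - y 0 ≤ ‖y - y'‖ := by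
    intro y y'
    have h2 := PiLp.norm_apply_le (y - y') 0
    rw [Real.norm_eq_abs, PiLp.sub_apply] at h2
    linarith [neg_abs_le (y 0 - y' 0)]
  have hcont : ∀ g1 g2 : ℝ → ℝ, Continuous g1 → Continuous g2 →
      Continuous (fun s => ins 0 (g1 s) (g2 s • e₁)) := by
    intro g1 g2 h1 h2
    exact (continuous_ins 0).comp (h1.prodMk (h2.smul continuous_const))
  have hu2 : cuspFun α (t / 2) ≤ 1 / 64 := by
    have h1 := cuspFun_le hα (show 0 < t / 2 by linarith) (by linarith)
    have : (t / 2) ^ 3 ≤ (1 / 8) ^ 3   := pow_le_pow_left₀ (by linarith) (by linarith) 3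
    norm_num at this ⊢; linarith
  have hu20 := cuspFun_nonneg α (t / 2)
  have hu00 : cuspFun α 0 = 0 := by simp [cuspFun]
  set γ1 : ℝ → Euc (k + 1) := fun s => ins 0 (-s) ((0 : ℝ) • e₁) with hγ1
  set γ2 : ℝ → Euc (k + 1) := fun s => ins 0 (t / 2) (s • e₁) with hγ2
  set γ4 : ℝ → Euc (k + 1) := fun s => ins 0 0 (s • e₁) with hγ4
  have c1 : Continuous γ1 := hcont (fun s => -s) (fun _ => 0) (by fun_prop) (by fun_prop)
  have c2 : Continuous γ2 := hcont (fun _ => t / 2) (fun s => s) (by fun_prop) (by fun_prop)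
  have c4 : Continuous γ4 := hcont (fun _ => 0) (fun s => s) (by fun_prop) (by fun_prop)
  set Γ1 := γ1 '' Ioc 0 (1 / 4) with hΓ1
  set Γ2 := γ2 '' Ioc (cuspFun α (t / 2)) (1 / 4) with hΓ2
  set Γ3 := γ1 '' Ico (3 / 4) 1 with hΓ3
  set Γ4 := γ4 '' Ico (3 / 4) 1 with hΓ4
  have p1 : IsPreconnected Γ1 := isPreconnected_Ioc.image _ c1.continuousOn
  have p2 : IsPreconnected Γ2 := isPreconnected_Ioc.image _ c2.continuousOn
  have p3 : IsPreconnected Γ3 := isPreconnected_Ico.image _ c1.continuousOn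
  have p4 : IsPreconnected Γ4 := isPreconnected_Ico.image _ c4.continuousOn
  have s1 : Γ1 ⊆ Ω := by
    rintro _ ⟨s, hs, rfl⟩
    rw [hγ1, hmem]
    exact ⟨by nlinarith [hs.1, hs.2], Or.inl (by linarith [hs.1])⟩
  have s2 : Γ2 ⊆ Ω := by
    rintro _ ⟨s, hs, rfl⟩
    rw [hγ2, hmem]
    exact ⟨by nlinarith [hs.1, hs.2], Or.inr (hs.1.trans_le (le_abs_self _))⟩
  have s3 : Γ3 ⊆ Ω := by
    rintro _ ⟨s, hs, rfl⟩
    rw [hγ1, hmem]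
    exact ⟨by nlinarith [hs.1, hs.2], Or.inl (by linarith [hs.1])⟩
  have s4 : Γ4 ⊆ Ω := by
    rintro _ ⟨s, hs, rfl⟩
    rw [hγ4, hmem]
    refine ⟨by nlinarith [hs.1, hs.2], Or.inr ?_⟩
    rw [hu00]
    exact lt_of_lt_of_le (by linarith [hs.1]) (le_abs_self _)
  have b1 : γ1 (1 / 4) ∈ Γ1 := ⟨1 / 4, ⟨by norm_num, le_rfl⟩, rfl⟩
  have b2 : γ2 (1 / 4) ∈ Γ2 := ⟨1 / 4, ⟨by linarith, le_rfl⟩, rfl⟩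
  have b3 : γ1 (3 / 4) ∈ Γ3 := ⟨3 / 4, ⟨le_rfl, by norm_num⟩, rfl⟩
  have b4 : γ4 (3 / 4) ∈ Γ4 := ⟨3 / 4, ⟨le_rfl, by norm_num⟩, rfl⟩
  have f1 : ‖F (γ1 (1 / 4))‖ < 1 - r := by simpa [hγ1] using hK1
  have f2 : ‖F (γ2 (1 / 4))‖ < 1 - r := hK2
  have f3 : ‖F (γ1 (3 / 4))‖ < 1 - r := by simpa [hγ1] using hK3
  have f4 : ‖F (γ4 (3 / 4))‖ < 1 - r := hK4
  have z1 : γ1 0 ∈ closure Γ1 := by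
    refine mem_closure_image c1.continuousAt ?_
    rw [closure_Ioc (by norm_num)]; exact ⟨le_rfl, by norm_num⟩
  have z2 : γ2 (cuspFun α (t / 2)) ∈ closure Γ2 := by
    refine mem_closure_image c2.continuousAt ?_
    rw [closure_Ioc (by intro h; linarith)]; exact ⟨le_rfl, by linarith⟩
  have z3 : γ1 1 ∈ closure Γ3 := by
    refine mem_closure_image c1.continuousAt ?_
    rw [closure_Ico (by norm_num)]; exact ⟨by norm_num, le_rfl⟩
  have z4 : γ4 1 ∈ closure Γ4 := by
    refine mem_closure_image c4.continuousAt ?_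
    rw [closure_Ico (by norm_num)]; exact ⟨by norm_num, le_rfl⟩
  have n1 : γ1 0 ∉ Ω := by
    rw [hγ1, hmem]
    rintro ⟨-, h | h⟩
    · norm_num at h
    · simp [hu00] at h
  have n2 : γ2 (cuspFun α (t / 2)) ∉ Ω := by
    rw [hγ2, hmem]
    rintro ⟨-, h | h⟩
    · linarith
    · rw [abs_of_nonneg hu20] at h
      exact lt_irrefl _ h
  have n3 : γ1 1 ∉ Ω := by
    rw [hγ1, hmem]
    rintro ⟨h, -⟩
    norm_num at h
  have n4 : γ4 1 ∉ Ω := by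
    rw [hγ4, hmem]
    rintro ⟨h, -⟩
    norm_num at h
  have in1 : ∀ y ∈ Γ1, y 0 < t ∧ ‖y‖ < 1 / 2 := by
    rintro _ ⟨s, hs, rfl⟩
    have h1 := hnorm (-s) 0
    refine ⟨by simp only [hγ1, ins_same]; linarith [hs.1], ?_⟩
    simp only [hγ1]
    nlinarith [hs.1, hs.2, norm_nonneg (ins 0 (-s) ((0:ℝ) • e₁))]
  have in2 : ∀ y ∈ Γ2, y 0 < t ∧ ‖y‖ < 1 / 2 := by
    rintro _ ⟨s, hs, rfl⟩
    have h1 := hnorm (t / 2) s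
    refine ⟨by simp only [hγ2, ins_same]; linarith [hs.1], ?_⟩
    simp only [hγ2]
    nlinarith [hs.1, hs.2, norm_nonneg (ins 0 (t / 2) (s • e₁))]
  have out3 : ∀ y ∈ Γ3, 1 / 2 < ‖y‖ := by
    rintro _ ⟨s, hs, rfl⟩
    have h1 := hnorm (-s) 0
    simp only [hγ1]
    nlinarith [hs.1, hs.2, norm_nonneg (ins 0 (-s) ((0:ℝ) • e₁))]
  have out4 : ∀ y ∈ Γ4, 1 / 2 < ‖y‖ := by
    rintro _ ⟨s, hs, rfl⟩
    have h1 := hnorm 0 s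
    simp only [hγ4]
    nlinarith [hs.1, hs.2, norm_nonneg (ins 0 0 (s • e₁))]
  have hA := pair_avoid hH hosc s1 s2 p1 p2 b1 b2 f1 f2 (by
    rintro _ ⟨s, hs, rfl⟩ _ ⟨s', hs', rfl⟩
    refine le_trans ?_ (hcoord _ _)
    simp only [hγ1, hγ2, ins_same]
    linarith [hs.1])
  have hB := pair_avoid hH hosc s3 s4 p3 p4 b3 b4 f3 f4 (by
    rintro _ ⟨s, hs, rfl⟩ _ ⟨s', hs', rfl⟩
    refine le_trans ?_ (hcoord _ _)
    simp only [hγ1, hγ4, ins_same]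
    linarith [hs.1])
  rcases hA with hA | hA <;> rcases hB with hB | hB
  · exact core_contra hα hH ht ht8 hr hrk hr1 hdisc s1 s3 p1 p3 b1 b3 f1 f3 z1 n1 z3 n3 hA hB in1 out3
  · exact core_contra hα hH ht ht8 hr hrk hr1 hdisc s1 s4 p1 p4 b1 b4 f1 f4 z1 n1 z4 n4 hA hB in1 out4
  · exact core_contra hα hH ht ht8 hr hrk hr1 hdisc s2 s3 p2 p3 b2 b3 f2 f3 z2 n2 z3 n3 hA hB in2 out3
  · exact core_contra hα hH ht ht8 hr hrk hr1 hdisc s2 s4 p2 p4 b2 b4 f2 f4 z2 n2 z4 n4 hA hB in2 out4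

theorem unit_limit {k : ℕ} {α : ℝ} {H F : Euc (k + 1) → Euc (k + 1)}
    (hH : IsHomeoOn H F (unitBall (k + 1)) (cuspBall (k + 1) (cuspFun α)))
    {Γ : Set (Euc (k + 1))} (hΓ : Γ ⊆ cuspBall (k + 1) (cuspFun α)) {z : Euc (k + 1)}
    (hz : z ∈ closure Γ) (hzn : z ∉ cuspBall (k + 1) (cuspFun α)) :
    ∃ x0 ∈ closure (F '' Γ), ‖x0‖ = 1 := by
  have hsub : F '' Γ ⊆ closedBall 0 1 := by
    rintro _ ⟨y, hy, rfl⟩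
    exact ball_subset_closedBall (hH.mapsTo_inv (hΓ hy))
  have hcl : closure (F '' Γ) ⊆ closedBall 0 1 := closure_minimal hsub isClosed_closedBall
  have hcomp : IsCompact (closure (F '' Γ)) :=
    (isCompact_closedBall _ _).of_isClosed_subset isClosed_closure hcl
  obtain ⟨y0, hy0, -⟩ := escape hH hΓ hz hzn (zero_lt_one)
  obtain ⟨x0, hx0, hmax⟩ := hcomp.exists_isMaxOn ⟨F y0, subset_closure ⟨y0, hy0, rfl⟩⟩
    continuous_norm.continuousOn
  refine ⟨x0, hx0, le_antisymm (by simpa using hcl hx0) ?_⟩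
  by_contra hlt
  push Not at hlt
  obtain ⟨y, hy, hyR⟩ := escape hH hΓ hz hzn hlt
  have : ‖F y‖ ≤ ‖x0‖ := hmax (subset_closure ⟨y, hy, rfl⟩)
  linarith

theorem homeo_conj {n : ℕ} {Ω : Set (Euc n)} {h f : Euc n → Euc n}
    (hH : IsHomeoOn h f (unitBall n) Ω) (L : Euc n ≃ₗᵢ[ℝ] Euc n) :
    IsHomeoOn (fun v => h (L v)) (fun y => L.symm (f y)) (unitBall n) Ω := by
  have hL : MapsTo L (unitBall n) (unitBall n) := by
    intro v hv
    simpa [unitBall] using hv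
  refine ⟨fun v hv => hH.mapsTo (hL hv), ?_, ?_, ?_, ?_, ?_⟩
  · intro y hy
    have := hH.mapsTo_inv hy
    simpa [unitBall] using this
  · intro x hx
    simp [hH.left_inv _ (hL hx)]
  · intro y hy
    simp [hH.right_inv y hy]
  · exact hH.continuousOn.comp L.continuous.continuousOn hL
  · exact L.symm.continuous.comp_continuousOn hH.continuousOn_inv

theorem exists_isom {n : ℕ} {v w : Euc n} (h : ‖v‖ = ‖w‖) :
    ∃ L : Euc n ≃ₗᵢ[ℝ] Euc n, L v = w :=
  ⟨(Submodule.span ℝ {v - w})ᗮ.reflection, Submodule.reflection_sub h⟩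

theorem num_choice {α c b0 ρ : ℝ} {n : ℕ} (hn : 1 ≤ n) (hα : (n : ℝ) ≤ α) (hc : 0 < c) (hb : 0 < b0) (hρ : ρ < 1) :
    ∀ᶠ τ in nhdsWithin (0 : ℝ) (Ioi 0), 0 < τ ∧ τ < 1 / 8 ∧
      Real.exp (-c * τ ^ (-α) / 2) ≤ b0 ∧ Real.exp (-c * τ ^ (-α) / 2) < 1 - ρ ∧
      3 * Real.exp (-c * τ ^ (-α)) < Real.exp (-c * τ ^ (-α) / 2) ∧
      (c / 4 * (1 / 8) ^ n) / Real.log (Real.exp (-c * τ ^ (-α) / 2) / (3 * Real.exp (-c * τ ^ (-α)))) ≤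
        (τ / 8) ^ n := by
  have hα0 : 0 < α := by
    have : (1:ℝ) ≤ n := by exact_mod_cast hn
    linarith
  have hX := tendsto_rpow_neg_nhdsGT_zero (show -α < 0 by linarith)
  have hE : Filter.Tendsto (fun τ : ℝ => Real.exp (-c * τ ^ (-α) / 2)) (nhdsWithin 0 (Ioi 0)) (nhds 0) := by
    refine Real.tendsto_exp_atBot.comp ?_
    have := hX.const_mul_atTop_of_neg (show -(c/2) < 0 by linarith)
    refine this.congr fun x => by ring
  have h1 : ∀ᶠ τ in nhdsWithin (0 : ℝ) (Ioi 0), τ < 1 / 8 :=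
    nhdsWithin_le_nhds (Iio_mem_nhds (by norm_num))
  filter_upwards [h1, self_mem_nhdsWithin, hE.eventually (gt_mem_nhds hb),
    hE.eventually (gt_mem_nhds (show 0 < 1 - ρ by linarith)), hE.eventually (gt_mem_nhds (show (0:ℝ) < 1 / 3 by norm_num)),
    hX.eventually_ge_atTop (8 / c)] with τ a1 a2 a3 a4 a5 a6
  have hτ : 0 < τ := a2
  set X := τ ^ (-α) with hXd
  have hsq : Real.exp (-c * X) = Real.exp (-c * X / 2) * Real.exp (-c * X / 2) := by
    rw [← Real.exp_add]; ring_nf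
  have hpos := Real.exp_pos (-c * X / 2)
  refine ⟨hτ, a1, a3.le, a4, by rw [hsq]; nlinarith, ?_⟩
  have hcX : 8 ≤ c * X := by
    rw [div_le_iff₀ hc] at a6; linarith
  have hlog : c / 4 * X ≤ Real.log (Real.exp (-c * X / 2) / (3 * Real.exp (-c * X))) := by
    rw [Real.log_div hpos.ne' (by positivity), Real.log_mul (by norm_num) (Real.exp_pos _).ne',
      Real.log_exp, Real.log_exp]
    have : Real.log 3 ≤ 2 := by
      have := Real.log_le_sub_one_of_pos (show (0:ℝ) < 3 by norm_num)
      linarith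
    linarith
  have hXp : 0 < X := Real.rpow_pos_of_pos hτ _
  have hinv : 1 ≤ X * τ ^ n := by
    rw [hXd, ← Real.rpow_natCast, ← Real.rpow_add hτ]
    exact Real.one_le_rpow_of_pos_of_le_one_of_nonpos hτ (by linarith) (by linarith)
  rw [div_le_iff₀ (lt_of_lt_of_le (by positivity) hlog), one_div_pow, div_pow]
  have h8 : (0:ℝ) < 8 ^ n := by positivity
  calc c / 4 * (1 / 8 ^ n) ≤ c / 4 * (1 / 8 ^ n) * (X * τ ^ n) := le_mul_of_one_le_right (by positivity) hinv
    _ = τ ^ n / 8 ^ n * (c / 4 * X) := by ring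
    _ ≤ _ := by gcongr

theorem base_bound {k : ℕ} {α : ℝ} (hα : 3 ≤ α) {h f : Euc (k + 1) → Euc (k + 1)}
    (hH : IsHomeoOn h f (unitBall (k + 1)) (cuspBall (k + 1) (cuspFun α)))
    {e₁ : Euc k} (he : ‖e₁‖ = 1) :
    ∃ ρ < 1, ‖f (ins 0 (-(1 / 4)) 0)‖ ≤ ρ ∧ ‖f (ins 0 (-(3 / 4)) 0)‖ ≤ ρ ∧
      ‖f (ins 0 0 ((3 / 4 : ℝ) • e₁))‖ ≤ ρ ∧
      ∀ s ∈ Icc (0 : ℝ) (1 / 8), ‖f (ins 0 s ((1 / 4 : ℝ) • e₁))‖ ≤ ρ := by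
  have hnorm : ∀ (a s : ℝ), ‖ins 0 a (s • e₁)‖ ^ 2 = a ^ 2 + s ^ 2 := by
    intro a s
    rw [norm_ins_sq, norm_smul, he, mul_one, Real.norm_eq_abs, sq_abs]
  have hmem : ∀ (a s : ℝ), ins 0 a (s • e₁) ∈ cuspBall (k + 1) (cuspFun α) ↔
      a ^ 2 + s ^ 2 < 1 ∧ (a < 0 ∨ cuspFun α a < |s|) := by
    intro a s
    rw [mem_cusp, ← hnorm, tl_ins, ins_same, norm_smul, he, mul_one, Real.norm_eq_abs,
      sq_lt_one_iff₀ (norm_nonneg _)]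
  have hcont : Continuous (fun s : ℝ => ins 0 s ((1 / 4 : ℝ) • e₁)) :=
    (continuous_ins 0).comp (continuous_id.prodMk continuous_const)
  have hu00 : cuspFun α 0 = 0 := by simp [cuspFun]
  have hz : (0 : Euc k) = (0 : ℝ) • e₁ := by simp
  obtain ⟨R1, hR1, h1⟩ := inner_bound hH (isCompact_singleton (x := ins 0 (-(1 / 4)) ((0 : ℝ) • e₁))) (by
    rw [singleton_subset_iff, hmem]; norm_num)
  obtain ⟨R2, hR2, h2⟩ := inner_bound hH (isCompact_singleton (x := ins 0 (-(3 / 4)) ((0 : ℝ) • e₁))) (by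
    rw [singleton_subset_iff, hmem]; norm_num)
  obtain ⟨R3, hR3, h3⟩ := inner_bound hH (isCompact_singleton (x := ins 0 0 ((3 / 4 : ℝ) • e₁))) (by
    rw [singleton_subset_iff, hmem, hu00]; norm_num)
  obtain ⟨R4, hR4, h4⟩ := inner_bound hH ((isCompact_Icc (a := (0:ℝ)) (b := 1 / 8)).image hcont) (by
    rintro _ ⟨s, hs, rfl⟩
    show ins 0 s ((1 / 4 : ℝ) • e₁) ∈ _
    rw [hmem]
    refine ⟨by nlinarith [hs.1, hs.2], Or.inr ?_⟩
    rw [abs_of_pos (by norm_num)]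
    have h18 := cuspFun_le hα (show (0:ℝ) < 1 / 8 by norm_num) (by norm_num)
    have := cuspFun_mono (show 0 < α by linarith) hs.2
    norm_num at h18 this ⊢
    linarith)
  refine ⟨max (max R1 R2) (max R3 R4), max_lt (max_lt hR1 hR2) (max_lt hR3 hR4), ?_, ?_, ?_, ?_⟩
  · rw [hz]; exact (h1 _ rfl).trans (by simp)
  · rw [hz]; exact (h2 _ rfl).trans (by simp)
  · exact (h3 _ rfl).trans (by simp)
  · intro s hs
    exact (h4 _ ⟨s, hs, rfl⟩).trans (by simp)

set_option maxHeartbeats 1000000 in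
theorem main_aux {d : ℕ} {α p : ℝ} (hα : ((d + 3 : ℕ) : ℝ) ≤ α) (hp : ((d + 2 : ℕ) : ℝ) < p)
    {h f : Euc (d + 2 + 1) → Euc (d + 2 + 1)}
    {Dh Df : Euc (d + 2 + 1) → Matrix (Fin (d + 2 + 1)) (Fin (d + 2 + 1)) ℝ}
    (hH : IsHomeoOn h f (unitBall (d + 2 + 1)) (cuspBall (d + 2 + 1) (cuspFun α)))
    (hSh : MemSobolev ((d + 2 + 1 : ℕ) : ℝ) (unitBall (d + 2 + 1)) h Dh)
    (hSf : MemSobolev p (cuspBall (d + 2 + 1) (cuspFun α)) f Df) : False := by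
  have hα3 : 3 ≤ α := by
    push_cast at hα
    have : (0:ℝ) ≤ d := Nat.cast_nonneg d
    linarith
  have hp1 : 1 < p := by
    push_cast at hp
    have : (0:ℝ) ≤ d := Nat.cast_nonneg d
    linarith
  set e₁ : Euc (d + 2) := EuclideanSpace.single 0 1 with he₁
  set e₂ : Euc (d + 2) := EuclideanSpace.single 1 1 with he₂
  have h1 : ‖e₁‖ = 1 := by simp [he₁]
  have h2 : ‖e₂‖ = 1 := by simp [he₂]
  have h12 : inner ℝ e₂ e₁ = 0 := by simp [he₁, he₂, EuclideanSpace.inner_single_left]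
  obtain ⟨c, hc, hev⟩ := osc_f hα3 hp1 hp h1 h2 h12 hH.continuousOn_inv hSf
  obtain ⟨ρ, hρ, hb1, hb2, hb3, hb4⟩ := base_bound hα3 hH h1
  obtain ⟨b0, hb0, hb0n, hoh⟩ := osc_h (d := d + 1) hH.continuousOn hSh
    (show 0 < c / 4 * (1 / 8 : ℝ) ^ (d + 3) by positivity)
  obtain ⟨τ, ⟨t, ⟨htτ, htτ'⟩, hosc⟩, hτ0, hτ8, n1, n2, n3, n4⟩ :=
    (hev.and (num_choice (n := d + 3) (by omega) hα hc hb0 hρ)).exists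
  set δ := Real.exp (-c * τ ^ (-α)) with hδ
  set b := Real.exp (-c * τ ^ (-α) / 2) with hb
  have hδ0 : 0 < δ := Real.exp_pos _
  have ht0 : 0 < t := by linarith
  set u := cuspFun α t with hu
  have hu0 : 0 < u := cuspFun_pos ht0
  have hut : u ≤ 1 / 64 := by
    have h1 := cuspFun_le hα3 ht0 (by linarith)
    have : t ^ 3 ≤ (1 / 8) ^ 3 := pow_le_pow_left₀ (by linarith) (by linarith) 3
    norm_num at this ⊢; linarith
  set γ : ℝ → Euc (d + 2 + 1) := fun s => ins 0 t (s • e₁) with hγ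
  have hγc : Continuous γ :=
    (continuous_ins 0).comp (continuous_const.prodMk (continuous_id.smul continuous_const))
  have hnorm : ∀ s : ℝ, ‖γ s‖ ^ 2 = t ^ 2 + s ^ 2 := by
    intro s
    rw [hγ, norm_ins_sq, norm_smul, h1, mul_one, Real.norm_eq_abs, sq_abs]
  have hmem : ∀ s : ℝ, γ s ∈ cuspBall (d + 2 + 1) (cuspFun α) ↔ t ^ 2 + s ^ 2 < 1 ∧ (t < 0 ∨ u < |s|) := by
    intro s
    rw [mem_cusp, ← hnorm, hγ, tl_ins, ins_same, norm_smul, h1, mul_one, Real.norm_eq_abs,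
      sq_lt_one_iff₀ (norm_nonneg _)]
  obtain ⟨x0, hx0, hx01⟩ := unit_limit (Γ := γ '' Ioc u (3 * u)) (z := γ u) hH (by
      rintro _ ⟨s, hs, rfl⟩
      rw [hmem]
      exact ⟨by nlinarith [hs.1, hs.2], Or.inr (hs.1.trans_le (le_abs_self _))⟩) (by
      refine mem_closure_image hγc.continuousAt ?_
      rw [closure_Ioc (by intro h; linarith)]; exact ⟨le_rfl, by linarith⟩) (by
      rw [hmem]
      rintro ⟨-, h | h⟩
      · linarith
      · rw [abs_of_pos hu0] at h
        exact lt_irrefl _ h)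
  set y0 := f (ins 0 t ((3 * u) • e₁)) with hy0
  have hx0y : ‖x0 - y0‖ ≤ δ := by
    have : closure (f '' (γ '' Ioc u (3 * u))) ⊆ closedBall y0 δ := by
      refine closure_minimal ?_ isClosed_closedBall
      rintro _ ⟨_, ⟨s, hs, rfl⟩, rfl⟩
      rw [mem_closedBall, dist_eq_norm]
      have hs0 : 0 < s := hu0.trans hs.1
      have hns : ‖s • e₁‖ = s := by rw [norm_smul, h1, mul_one, Real.norm_eq_abs, abs_of_pos hs0]
      exact hosc (s • e₁) (by rw [hns]; exact hs.1) (by rw [hns]; exact hs.2)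
    have := this hx0
    rwa [mem_closedBall, dist_eq_norm] at this
  obtain ⟨L, hL⟩ := exists_isom (v := (EuclideanSpace.single 0 1 : Euc (d + 2 + 1))) (w := x0)
    (by rw [hx01]; simp)
  obtain ⟨r, ⟨hr1, hr2⟩, hrosc⟩ := hoh L (3 * δ) b (by positivity) n3 n1
  have hr0 : 0 < r := by linarith
  have hrb : ((d : ℝ) + 3) * r ≤ 1 := by
    have hrb0 : r ≤ b0 := by linarith
    push_cast at hb0n
    have : (0:ℝ) ≤ d := Nat.cast_nonneg d
    nlinarith
  have hsymm : ∀ y, ‖L.symm y‖ = ‖y‖ := fun y => L.symm.norm_map y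
  refine topo_contra hα3 (homeo_conj hH L) ht0 (by linarith) hr0 (by push_cast; linarith) ?_ h1
    (r := r) ?_ ?_ ?_ ?_ ?_ ?_
  · have : (0:ℝ) ≤ d := Nat.cast_nonneg d
    nlinarith
  · simp only [hsymm]; linarith
  · simp only [hsymm]; linarith
  · simp only [hsymm]; linarith
  · simp only [hsymm]
    have := hb4 (t / 2) ⟨by linarith, by linarith⟩
    linarith
  · intro v v' hv hv' hc hc'
    have h3 := (hrosc v v' hv hv' hc hc').trans n4
    have h4 := le_of_pow_le_pow_left₀ (by omega) (by positivity) h3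
    linarith
  · intro x hx hx'
    have h3 : L.symm (f (ins 0 t x)) - EuclideanSpace.single 0 1 = L.symm (f (ins 0 t x) - x0) := by
      rw [map_sub, ← hL, L.symm_apply_apply]
    simp only [h3, hsymm]
    have h4 := hosc x hx hx'
    have h5 := norm_sub_le_norm_sub_add_norm_sub (f (ins 0 t x)) y0 x0
    rw [norm_sub_rev y0 x0] at h5
    linarith

/-- For `n ≥ 3`, `α ≥ n`, `p > n − 1` and `u(t) = e / exp(t^{−α})`, there is
no homeomorphism `h : 𝔹 → 𝔹_u` with `h ∈ W^{1,n}(𝔹)` and `h⁻¹ ∈ W^{1,p}(𝔹_u)`. -/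
theorem stmt_9 {n : ℕ} [NeZero n] (hn : 3 ≤ n) (α p : ℝ) (hα : (n : ℝ) ≤ α)
    (hp : (n : ℝ) - 1 < p) :
    ¬ ∃ (h f : Euc n → Euc n) (Dh Df : Euc n → Matrix (Fin n) (Fin n) ℝ),
        IsHomeoOn h f (unitBall n) (cuspBall n (cuspFun α)) ∧
        MemSobolev (n : ℝ) (unitBall n) h Dh ∧
        MemSobolev p (cuspBall n (cuspFun α)) f Df := by
  rintro ⟨h, f, Dh, Df, hH, hSh, hSf⟩
  obtain ⟨d, rfl⟩ : ∃ d, n = d + 2 + 1 := ⟨n - 3, by omega⟩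
  refine main_aux (d := d) (p := p) hα ?_ hH hSh hSf
  push_cast at hp ⊢
  linarith
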